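/- arXiv:1301.4574 — 10 statements merged into one kernel-verified Lean document; each statement's English description precedes it below -/
import Mathlib

section
/- Let X be a Banach space over ℝ or ℂ and let 0 < ε. If x ∈ X and x* ∈ X* satisfy ‖x‖ = ‖x*‖ = 1 and Re x*(x) ≥ 1 − ε²/2, then there exist x₀ ∈ X and x₀* ∈ X* such that ‖x₀‖ = ‖x₀*‖ = x₀*(x₀) = 1, ‖x − x₀‖ ≤ ε and ‖x* − x₀*‖ ≤ ε. -/
open Filter Topology

/-- **Ekeland's variational principle**: a continuous function `φ` that is bounded above on a
complete metric space admits, above every point, a point at which `φ` is maximal up to a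
perturbation of slope `k`. -/
theorem exists_ekeland_maximum {α : Type*} [MetricSpace α] [CompleteSpace α] {φ : α → ℝ}
    (hφ : Continuous φ) (hbdd : BddAbove (Set.range φ)) {k : ℝ} (hk : 0 < k) (x : α) :
    ∃ v, k * dist v x ≤ φ v - φ x ∧ ∀ w, φ w - φ v ≤ k * dist w v := by
  have step : ∀ (v : α) (n : ℕ), ∃ u, k * dist u v ≤ φ u - φ v ∧
      ∀ w, k * dist w v ≤ φ w - φ v → φ w ≤ φ u + 1 / ((n : ℝ) + 1) := by
    intro v n
    set S : Set α := {w | k * dist w v ≤ φ w - φ v}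
    have hne : (φ '' S).Nonempty := ⟨φ v, v, by simp [S], rfl⟩
    obtain ⟨_, ⟨u, hu, rfl⟩, hlt⟩ := exists_lt_of_lt_csSup hne
      (sub_lt_self (sSup (φ '' S)) (Nat.one_div_pos_of_nat (α := ℝ) (n := n)))
    refine ⟨u, hu, fun w hw => ?_⟩
    have := le_csSup (hbdd.mono (Set.image_subset_range φ S)) (Set.mem_image_of_mem φ hw)
    linarith
  choose next hnext hmax using step
  let v : ℕ → α := fun n => Nat.rec x (fun n u => next u n) n
  have hv (n : ℕ) : v (n + 1) = next (v n) n := rfl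
  have hle : ∀ n m, n ≤ m → k * dist (v m) (v n) ≤ φ (v m) - φ (v n) := by
    intro n m hnm
    induction m, hnm using Nat.le_induction with
    | base => simp
    | succ m _ ih =>
      have h₁ := hnext (v m) m
      rw [← hv] at h₁
      have h₂ := mul_le_mul_of_nonneg_left (dist_triangle (v (m + 1)) (v m) (v n)) hk.le
      linarith
  have hmono : Monotone fun n => φ (v n) := fun n m hnm => by
    have := hle n m hnm
    have : 0 ≤ k * dist (v m) (v n) := by positivity
    simp only
    linarith
  have hbdd' : BddAbove (Set.range fun n => φ (v n)) :=
    hbdd.mono (Set.range_comp_subset_range v φ)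
  have hlim := tendsto_atTop_ciSup hmono hbdd'
  set L := ⨆ n, φ (v n)
  have hcauchy : CauchySeq v := by
    refine cauchySeq_of_le_tendsto_0' (fun n => (L - φ (v n)) / k) (fun n m hnm => ?_) ?_
    · rw [dist_comm, le_div_iff₀ hk, mul_comm]
      exact (hle n m hnm).trans (sub_le_sub_right (le_ciSup hbdd' m) _)
    · simpa using (hlim.const_sub L).div_const k
  obtain ⟨a, ha⟩ := cauchySeq_tendsto_of_complete hcauchy
  have hφa : Tendsto (fun n => φ (v n)) atTop (𝓝 (φ a)) := (hφ.tendsto a).comp ha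
  have hav : ∀ n, k * dist a (v n) ≤ φ a - φ (v n) := fun n =>
    le_of_tendsto_of_tendsto ((ha.dist tendsto_const_nhds).const_mul k) (hφa.sub_const _)
      ((eventually_ge_atTop n).mono fun m hm => hle n m hm)
  refine ⟨a, hav 0, fun w => ?_⟩
  by_contra! hw
  have hwv : ∀ n, φ w ≤ φ (v (n + 1)) + 1 / ((n : ℝ) + 1) := fun n => by
    rw [hv]
    refine hmax (v n) n w ?_
    have := mul_le_mul_of_nonneg_left (dist_triangle w a (v n)) hk.le
    linarith [hav n]
  have hwa : φ w ≤ φ a + 0 := ge_of_tendsto'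
    ((hφa.comp (tendsto_add_atTop_nat 1)).add tendsto_one_div_add_atTop_nhds_zero_nat) hwv
  have : 0 ≤ k * dist w a := by positivity
  linarith

/-- If `f` exceeds its value at `z ∈ C` by at most `k * ‖w - z‖` on the convex set `C`, then some
functional within `k` of `f` attains its maximum over `C` at `z`. -/
theorem exists_dual_isMaxOn_of_sub_le_mul_norm {E : Type*} [NormedAddCommGroup E] [NormedSpace ℝ E]
    {C : Set E} (hC : Convex ℝ C) {z : E} (hz : z ∈ C) (f : StrongDual ℝ E) {k : ℝ} (hk : 0 ≤ k)
    (h : ∀ w ∈ C, f w - f z ≤ k * ‖w - z‖) :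
    ∃ g : StrongDual ℝ E, ‖f - g‖ ≤ k ∧ IsMaxOn g C z := by
  have hs : Convex ℝ {p : E × ℝ | k * ‖p.1‖ < p.2} := by
    intro p hp q hq a b ha hb hab
    simp only [Set.mem_ofPred_eq, Prod.fst_add, Prod.snd_add, Prod.smul_fst, Prod.smul_snd,
      smul_eq_mul] at hp hq ⊢
    have h₁ : ‖a • p.1 + b • q.1‖ ≤ a * ‖p.1‖ + b * ‖q.1‖ := by
      simpa [norm_smul, abs_of_nonneg ha, abs_of_nonneg hb] using norm_add_le (a • p.1) (b • q.1)
    have h₂ := mul_le_mul_of_nonneg_left h₁ hk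
    rcases ha.eq_or_lt with rfl | ha
    · obtain rfl : b = 1 := by linarith
      simpa using hq
    · nlinarith [mul_lt_mul_of_pos_left hp ha, mul_le_mul_of_nonneg_left hq.le hb]
  have ht : Convex ℝ {p : E × ℝ | p.1 + z ∈ C ∧ p.2 ≤ f p.1} := by
    rintro p ⟨hp, hp'⟩ q ⟨hq, hq'⟩ a b ha hb hab
    refine ⟨?_, ?_⟩
    · convert hC hp hq ha hb hab using 1
      rw [smul_add, smul_add, add_add_add_comm, ← add_smul, hab, one_smul]
      rfl
    · simpa using add_le_add (mul_le_mul_of_nonneg_left hp' ha) (mul_le_mul_of_nonneg_left hq' hb)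
  have hopen : IsOpen {p : E × ℝ | k * ‖p.1‖ < p.2} :=
    isOpen_lt (by fun_prop) (by fun_prop)
  have hdisj : Disjoint {p : E × ℝ | k * ‖p.1‖ < p.2} {p : E × ℝ | p.1 + z ∈ C ∧ p.2 ≤ f p.1} := by
    refine Set.disjoint_left.2 fun p hp hp' => ?_
    have := h _ hp'.1
    rw [map_add, add_sub_cancel_right, add_sub_cancel_right] at this
    exact absurd (hp.trans_le (hp'.2.trans this)) (lt_irrefl _)
  obtain ⟨F, c, hFs, hFt⟩ := geometric_hahn_banach_open hs hopen ht hdisj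
  set φ : StrongDual ℝ E := F.comp (ContinuousLinearMap.inl ℝ E ℝ)
  set a : ℝ := F (0, 1)
  have hF : ∀ u s, F (u, s) = φ u + s * a := fun u s => by
    have : ((u, s) : E × ℝ) = (u, 0) + s • (0, 1) := by simp
    rw [this, map_add, map_smul]
    rfl
  have hc : c ≤ 0 := by simpa [hF] using hFt (0, 0) (by simpa using hz)
  have ha : a < 0 := by
    have := hFs (0, 1) (by simp)
    rw [hF] at this
    simp only [map_zero] at this
    linarith
  have hφ : ∀ u, φ u ≤ k * ‖u‖ * (-a) := fun u => by
    refine le_of_forall_pos_lt_add fun δ hδ => ?_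
    have hpos : 0 < δ / (-a) := div_pos hδ (neg_pos.2 ha)
    have := hFs (u, k * ‖u‖ + δ / (-a)) (by simpa using hpos)
    rw [hF] at this
    have hδa : δ / (-a) * (-a) = δ := div_mul_cancel₀ _ (neg_pos.2 ha).ne'
    linarith
  have hc₀ : 0 ≤ c := by
    refine le_of_forall_pos_le_add fun δ hδ => ?_
    have hpos : 0 < δ / (-a) := div_pos hδ (neg_pos.2 ha)
    have := hFs (0, δ / (-a)) (by simpa using hpos)
    rw [hF, map_zero] at this
    have hδa : δ / (-a) * (-a) = δ := div_mul_cancel₀ _ (neg_pos.2 ha).ne'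
    linarith
  have hle : ∀ u, (-a)⁻¹ * φ u ≤ k * ‖u‖ := fun u => by
    rw [inv_mul_le_iff₀ (neg_pos.2 ha)]
    linarith [hφ u]
  refine ⟨f - (-a)⁻¹ • φ, ?_, fun w hw => ?_⟩
  · rw [sub_sub_cancel]
    refine ContinuousLinearMap.opNorm_le_bound _ hk fun u => ?_
    have := hle (-u)
    rw [map_neg, norm_neg] at this
    simp only [smul_apply, smul_eq_mul, Real.norm_eq_abs]
    exact abs_le.2 ⟨by linarith, hle u⟩
  · have hw' := hFt (w - z, f (w - z)) ⟨by simpa using hw, le_rfl⟩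
    rw [hF] at hw'
    have : f (w - z) ≤ (-a)⁻¹ * φ (w - z) := by
      rw [le_inv_mul_iff₀ (neg_pos.2 ha)]
      linarith
    simp only [map_sub] at this
    simp only [Set.mem_ofPred_eq, sub_apply, smul_apply,
      smul_eq_mul]
    linarith

/-- A functional attaining its maximum over the closed unit ball at `z` takes its norm there. -/
theorem apply_eq_norm_of_isMaxOn_closedBall {E : Type*} [NormedAddCommGroup E] [NormedSpace ℝ E]
    {g : StrongDual ℝ E} {z : E} (hz : ‖z‖ ≤ 1) (h : IsMaxOn g (Metric.closedBall 0 1) z) :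
    g z = ‖g‖ := by
  refine le_antisymm ((le_abs_self _).trans ((g.le_opNorm z).trans
    (mul_le_of_le_one_right (norm_nonneg g) hz))) ?_
  have hle : ∀ u, ‖u‖ ≤ 1 → g u ≤ g z := fun u hu => h (by simpa using hu)
  have h₀ : 0 ≤ g z := by simpa using hle 0 (by simp)
  refine ContinuousLinearMap.opNorm_le_of_unit_norm h₀ fun u hu => ?_
  have := hle (-u) (by simp [hu])
  rw [map_neg] at this
  exact abs_le.2 ⟨by linarith, hle u hu.le⟩

/-- The real Bishop–Phelps–Bollobás theorem for `ε = 2 * k < 2`. -/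
theorem exists_norm_attaining_near_real {E : Type*} [NormedAddCommGroup E] [NormedSpace ℝ E]
    [CompleteSpace E] {k : ℝ} (hk : 0 < k) (hk1 : k < 1) {x : E} {f : StrongDual ℝ E}
    (hx : ‖x‖ = 1) (hf : ‖f‖ = 1) (hfx : 1 - 2 * k ^ 2 ≤ f x) :
    ∃ (x₀ : E) (g : StrongDual ℝ E),
      ‖x₀‖ = 1 ∧ ‖g‖ = 1 ∧ g x₀ = 1 ∧ ‖x - x₀‖ ≤ 2 * k ∧ ‖f - g‖ ≤ 2 * k := by
  have hf1 : ∀ u, ‖u‖ ≤ 1 → f u ≤ 1 := fun u hu =>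
    (le_abs_self _).trans ((f.le_opNorm u).trans (by simpa [hf] using hu))
  have : CompleteSpace (Metric.closedBall (0 : E) 1) :=
    Metric.isClosed_closedBall.completeSpace_coe
  obtain ⟨⟨z, hz⟩, hzx, hzmax⟩ := exists_ekeland_maximum
    (φ := fun u : Metric.closedBall (0 : E) 1 => f u) (by fun_prop)
    ⟨1, by rintro _ ⟨⟨u, hu⟩, rfl⟩; exact hf1 u (by simpa using hu)⟩ hk
    ⟨x, by simp [hx]⟩
  have hz1 : ‖z‖ ≤ 1 := by simpa using hz
  simp only [Subtype.dist_eq, dist_eq_norm] at hzx hzmax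
  obtain ⟨g, hfg, hg⟩ := exists_dual_isMaxOn_of_sub_le_mul_norm (convex_closedBall (0 : E) 1) hz f
    hk.le fun w hw => hzmax ⟨w, hw⟩
  have hgz := apply_eq_norm_of_isMaxOn_closedBall hz1 hg
  have hdiff : |‖g‖ - 1| ≤ k := by
    rw [← hf, abs_sub_comm]
    exact (abs_norm_sub_norm_le f g).trans hfg
  have hgpos : 0 < ‖g‖ := by linarith [(abs_le.1 hdiff).1]
  have hznorm : ‖z‖ = 1 := by
    refine le_antisymm hz1 ?_
    have := (le_abs_self _).trans (g.le_opNorm z)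
    rw [hgz] at this
    exact le_of_mul_le_mul_left (by simpa using this) hgpos
  refine ⟨z, ‖g‖⁻¹ • g, hznorm, ?_, ?_, ?_, ?_⟩
  · rw [norm_smul, norm_inv, norm_norm, inv_mul_cancel₀ hgpos.ne']
  · simp [hgz, hgpos.ne']
  · rw [norm_sub_rev]
    refine le_of_mul_le_mul_left ?_ hk
    linarith [hf1 z hz1]
  · have h₂ : ‖g - ‖g‖⁻¹ • g‖ = |‖g‖ - 1| := by
      have : g - ‖g‖⁻¹ • g = ((‖g‖ - 1) * ‖g‖⁻¹) • g := by
        rw [sub_mul, mul_inv_cancel₀ hgpos.ne', one_mul]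
        module
      rw [this, norm_smul, norm_mul, norm_inv, norm_norm, mul_assoc, inv_mul_cancel₀ hgpos.ne',
        mul_one, Real.norm_eq_abs]
    linarith [norm_sub_le_norm_sub_add_norm_sub f g (‖g‖⁻¹ • g)]

/-- **Bishop–Phelps–Bollobás theorem.**  Let `X` be a Banach space over `ℝ` or `ℂ`
and `0 < ε`.  If `‖x‖ = ‖x*‖ = 1` and `Re x*(x) ≥ 1 - ε²/2`, then there are `x₀` and
`x₀*` with `‖x₀‖ = ‖x₀*‖ = x₀*(x₀) = 1`, `‖x - x₀‖ ≤ ε` and `‖x* - x₀*‖ ≤ ε`. -/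
theorem bishop_phelps_bollobas
    (𝕜 : Type*) [RCLike 𝕜] (X : Type*) [NormedAddCommGroup X] [NormedSpace 𝕜 X]
    [CompleteSpace X] (ε : ℝ) (hε : 0 < ε)
    (x : X) (f : X →L[𝕜] 𝕜) (hx : ‖x‖ = 1) (hf : ‖f‖ = 1)
    (hfx : 1 - ε ^ 2 / 2 ≤ RCLike.re (f x)) :
    ∃ (x₀ : X) (f₀ : X →L[𝕜] 𝕜),
      ‖x₀‖ = 1 ∧ ‖f₀‖ = 1 ∧ f₀ x₀ = 1 ∧ ‖x - x₀‖ ≤ ε ∧ ‖f - f₀‖ ≤ ε := by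
  rcases le_or_gt 2 ε with h2 | h2
  · obtain ⟨g, hg, hgx⟩ := exists_dual_vector 𝕜 x (by simp [hx])
    refine ⟨x, g, hx, hg, by simp [hgx, hx], by simpa using hε.le, ?_⟩
    linarith [norm_sub_le f g]
  let _ : NormedSpace ℝ X := NormedSpace.restrictScalars ℝ 𝕜 X
  let e : StrongDual ℝ X ≃ₗᵢ[ℝ] StrongDual 𝕜 X := StrongDual.extendRCLikeₗᵢ
  have he : ∀ (g : StrongDual ℝ X) (u : X), RCLike.re (e g u) = g u := fun g u =>
    g.re_extendRCLike_apply u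
  obtain ⟨x₀, g, hx₀, hg, hgx, hxx, hfg⟩ := exists_norm_attaining_near_real (k := ε / 2)
    (f := e.symm f) (half_pos hε) (by linarith) hx (by simpa using hf)
    (by rw [← he, e.apply_symm_apply]; linarith)
  rw [mul_div_cancel₀ ε two_ne_zero] at hxx hfg
  have heg : ‖e g‖ = 1 := by rw [e.norm_map, hg]
  refine ⟨x₀, e g, hx₀, heg, ?_, hxx, ?_⟩
  · have hre : RCLike.re (e g x₀) = 1 := by rw [he, hgx]
    have hle : ‖e g x₀‖ ≤ RCLike.re (e g x₀) := by
      rw [hre]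
      simpa [heg, hx₀] using (e g).le_opNorm x₀
    rw [← RCLike.re_eq_self_of_le hle, hre, RCLike.ofReal_one]
  · rwa [← e.apply_symm_apply f, ← map_sub, e.norm_map]
end

section
/- Let x ∈ ℓ₁ with ‖x‖ ≤ 1, φ ∈ ℓ∞ with ‖φ‖ ≤ 1, and 0 < δ < 1 be such that Re(∑ⱼ φⱼ xⱼ) ≥ 1 − δ. Then for every r with δ < r < 1 one has ∑_{j ∈ P(r)} |Re(e^{i·arg(φⱼ)} xⱼ)| ≥ 1 − δ/r, where P(r) = {j ∈ ℕ : xⱼ ≠ 0 and Re(φⱼ xⱼ) ≥ (1 − r)|xⱼ|}. -/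
open scoped ENNReal

/-- Rotating by the argument of `w` instead of multiplying by `w` can only enlarge the
absolute value of the real part when `w` lies in the unit disc. -/
theorem re_mul_le_abs_re_exp_arg_mul {w : ℂ} (hw : ‖w‖ ≤ 1) (z : ℂ) :
    (w * z).re ≤ |(Complex.exp (Complex.arg w * Complex.I) * z).re| := by
  have h : (w * z).re = ‖w‖ * (Complex.exp (Complex.arg w * Complex.I) * z).re := by
    rw [← Complex.re_ofReal_mul, ← mul_assoc, Complex.norm_mul_exp_arg_mul_I]
  rw [h]
  refine (le_abs_self _).trans ?_
  rw [abs_mul, abs_norm]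
  exact mul_le_of_le_one_left (abs_nonneg _) hw

theorem abs_re_exp_arg_mul_le (w z : ℂ) :
    |(Complex.exp (Complex.arg w * Complex.I) * z).re| ≤ ‖z‖ := by
  refine (Complex.abs_re_le_norm _).trans ?_
  rw [norm_mul, Complex.norm_exp_ofReal_mul_I, one_mul]

/-- Key lemma: if `‖x‖ ≤ 1` in `ℓ₁(ℂ)`, `‖φ‖ ≤ 1` in `ℓ∞(ℂ)`, `0 < δ < 1` and
`Re(∑ⱼ φⱼ xⱼ) ≥ 1 - δ`, then for every `δ < r < 1`, the set
`P(r) = {j : xⱼ ≠ 0 ∧ Re(φⱼ xⱼ) ≥ (1-r)|xⱼ|}` satisfies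
`∑_{j ∈ P(r)} |Re(e^{i·arg(φⱼ)} xⱼ)| ≥ 1 - δ/r`. -/
theorem key_lemma_l1
    (x : lp (fun _ : ℕ => ℂ) 1) (φ : lp (fun _ : ℕ => ℂ) ∞)
    (hx : ‖x‖ ≤ 1) (hφ : ‖φ‖ ≤ 1) (δ : ℝ) (hδ0 : 0 < δ) (hδ1 : δ < 1)
    (hpair : 1 - δ ≤ (∑' j : ℕ, φ j * x j).re)
    (r : ℝ) (hr1 : δ < r) (hr2 : r < 1) :
    1 - δ / r ≤
      ∑' j : {j : ℕ // x j ≠ 0 ∧ (1 - r) * ‖x j‖ ≤ (φ j * x j).re},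
        |(Complex.exp (Complex.arg (φ j) * Complex.I) * x j).re| := by
  set a : ℕ → ℝ := fun j => |(Complex.exp (Complex.arg (φ j) * Complex.I) * x j).re|
  set P : Set ℕ := {j | x j ≠ 0 ∧ (1 - r) * ‖x j‖ ≤ (φ j * x j).re}
  change 1 - δ / r ≤ ∑' j : P, a j
  rw [tsum_subtype P a]
  have hφj (j : ℕ) : ‖φ j‖ ≤ 1 := (lp.norm_apply_le_norm ENNReal.top_ne_zero φ j).trans hφ
  have hxs : HasSum (fun j => ‖x j‖) ‖x‖ := by
    simpa using lp.hasSum_norm (p := 1) (by simp) x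
  have hab (j : ℕ) : (φ j * x j).re ≤ a j := re_mul_le_abs_re_exp_arg_mul (hφj j) _
  have hax (j : ℕ) : a j ≤ ‖x j‖ := abs_re_exp_arg_mul_le _ _
  have has : Summable (P.indicator a) :=
    (Summable.of_nonneg_of_le (fun j => abs_nonneg _) hax hxs.summable).indicator P
  have hprod : Summable fun j => φ j * x j := by
    refine Summable.of_norm_bounded hxs.summable fun j => ?_
    rw [norm_mul]
    exact mul_le_of_le_one_left (norm_nonneg _) (hφj j)
  have hpoint (j : ℕ) : (φ j * x j).re ≤ r * P.indicator a j + (1 - r) * ‖x j‖ := by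
    by_cases hj : j ∈ P
    · rw [Set.indicator_of_mem hj]
      nlinarith [hab j, hax j]
    · rw [Set.indicator_of_notMem hj]
      by_cases h0 : x j = 0
      · simp [h0]
      · have : (φ j * x j).re < (1 - r) * ‖x j‖ := lt_of_not_ge fun h => hj ⟨h0, h⟩
        linarith
  have hsum : (∑' j, φ j * x j).re ≤ r * ∑' j, P.indicator a j + (1 - r) * ‖x‖ :=
    hasSum_le hpoint (Complex.hasSum_re hprod.hasSum)
      ((has.hasSum.mul_left r).add (hxs.mul_left (1 - r)))
  have hr0 : 0 < r := hδ0.trans hr1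
  have hmain : r - δ ≤ r * ∑' j, P.indicator a j := by nlinarith
  rw [one_sub_div hr0.ne', div_le_iff₀ hr0]
  linarith
end

section
/- Let x ∈ ℓ₁ with ‖x‖ ≤ 1, φ ∈ ℓ∞ with ‖φ‖ ≤ 1, and 0 < ε < 1 be such that Re(∑ⱼ φⱼ xⱼ) ≥ 1 − ε³/4. Let P = {j ∈ ℕ : xⱼ ≠ 0 and Re(φⱼ xⱼ) ≥ (1 − ε²/2)|xⱼ|}. Then the vector x₀ = ‖x·𝟙_P‖⁻¹ · x·𝟙_P (the restriction of x to the coordinates in P, normalized in ℓ₁) and the sequence φ₀ defined by (φ₀)ⱼ = e^{−i·arg(xⱼ)} for j ∈ P and (φ₀)ⱼ = φⱼ for j ∉ P satisfy: ‖x₀‖ = ‖φ₀‖ = 1, ∑ⱼ (φ₀)ⱼ (x₀)ⱼ = 1, ‖x − x₀‖ ≤ ε and ‖φ − φ₀‖_∞ ≤ ε. -/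
open scoped ENNReal

theorem lp_one_summable_norm (x : lp (fun _ : ℕ => ℂ) 1) : Summable fun j => ‖x j‖ := by
  simpa using (lp.memℓp x).summable (by simp)

theorem lp_one_norm_eq_tsum (x : lp (fun _ : ℕ => ℂ) 1) : ‖x‖ = ∑' j, ‖x j‖ := by
  simpa using lp.norm_eq_tsum_rpow (by simp) x

theorem exp_neg_arg_mul_self (z : ℂ) :
    Complex.exp (-(Complex.arg z) * Complex.I) * z = (‖z‖ : ℂ) := by
  conv_lhs => rw [← Complex.norm_mul_exp_arg_mul_I z, mul_left_comm, ← Complex.exp_add]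
  simp

theorem norm_exp_neg_arg (z : ℂ) : ‖Complex.exp (-(Complex.arg z) * Complex.I)‖ = 1 := by
  simpa using Complex.norm_exp_ofReal_mul_I (-Complex.arg z)

/-- If `Re (w z)` is close to `‖z‖` and `‖w‖ ≤ 1`, then `w` is close to the conjugate phase
of `z`. -/
theorem norm_sub_exp_neg_arg_le {w z : ℂ} {ε : ℝ} (hε : 0 ≤ ε) (hz : z ≠ 0) (hw : ‖w‖ ≤ 1)
    (h : (1 - ε ^ 2 / 2) * ‖z‖ ≤ (w * z).re) :
    ‖w - Complex.exp (-(Complex.arg z) * Complex.I)‖ ≤ ε := by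
  have hz' : 0 < ‖z‖ := norm_pos_iff.mpr hz
  have hmul : ‖w - Complex.exp (-(Complex.arg z) * Complex.I)‖ * ‖z‖ = ‖w * z - (‖z‖ : ℂ)‖ := by
    rw [← norm_mul, sub_mul, exp_neg_arg_mul_self]
  refine le_of_mul_le_mul_right ?_ hz'
  rw [hmul]
  refine le_of_sq_le_sq ?_ (by positivity)
  have hsq : ‖w * z - (‖z‖ : ℂ)‖ ^ 2 = ‖w * z‖ ^ 2 - 2 * ‖z‖ * (w * z).re + ‖z‖ ^ 2 := by
    simp only [Complex.sq_norm, Complex.normSq_apply, Complex.sub_re, Complex.sub_im,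
      Complex.ofReal_re, Complex.ofReal_im]
    ring_nf
    rw [Complex.sq_norm, Complex.normSq_apply]
    ring
  have hwz : ‖w * z‖ ≤ ‖z‖ := by
    rw [norm_mul]; exact mul_le_of_le_one_left hz'.le hw
  rw [hsq]
  nlinarith [mul_le_mul_of_nonneg_left h hz'.le, norm_nonneg (w * z)]

/-- The part of the `ℓ₁` norm carried by the coordinates where `φ` almost norms `x`. -/
theorem tsum_norm_sub_indicator_le (x : lp (fun _ : ℕ => ℂ) 1) (φ : lp (fun _ : ℕ => ℂ) ∞)
    (hφ : ‖φ‖ ≤ 1) (c : ℝ) (P : Set ℕ)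
    (hP : P = {j : ℕ | x j ≠ 0 ∧ (1 - c) * ‖x j‖ ≤ (φ j * x j).re}) :
    (∑' j, φ j * x j).re ≤ ‖x‖ - c * (‖x‖ - ∑' j, P.indicator (fun j => ‖x j‖) j) := by
  have hs := lp_one_summable_norm x
  have hsP : Summable fun j => P.indicator (fun j => ‖x j‖) j := hs.indicator P
  have hle : ∀ j, ‖φ j * x j‖ ≤ ‖x j‖ := fun j => by
    rw [norm_mul]
    exact mul_le_of_le_one_left (norm_nonneg _)
      ((lp.norm_apply_le_norm ENNReal.top_ne_zero φ j).trans hφ)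
  have hsφ : Summable fun j => φ j * x j := Summable.of_norm_bounded hs hle
  rw [Complex.re_tsum hsφ, lp_one_norm_eq_tsum, ← hs.tsum_sub hsP, ← tsum_mul_left,
    ← hs.tsum_sub ((hs.sub hsP).mul_left c)]
  refine (Complex.reCLM.summable hsφ).tsum_le_tsum (fun j => ?_)
    (hs.sub ((hs.sub hsP).mul_left c))
  by_cases hj : j ∈ P
  · simpa [hj] using (Complex.re_le_norm _).trans (hle j)
  · simp only [hj, not_false_eq_true, Set.indicator_of_notMem, sub_zero]
    by_cases h0 : x j = 0
    · simp [h0]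
    · have : ¬ (1 - c) * ‖x j‖ ≤ (φ j * x j).re := fun h => hj (by rw [hP]; exact ⟨h0, h⟩)
      linarith

/-- First constructive Bishop–Phelps–Bollobás theorem in `ℓ₁(ℂ)`.  With
`P = {j : xⱼ ≠ 0 ∧ Re(φⱼxⱼ) ≥ (1-ε²/2)|xⱼ|}` and `M = ‖x·𝟙_P‖`, the normalized
restriction `x₀ = M⁻¹ · x·𝟙_P` and the sequence `φ₀` equal to `e^{-i arg(xⱼ)}` on `P`
and to `φ` off `P` satisfy `‖x₀‖ = ‖φ₀‖ = 1`, `∑ⱼ (φ₀)ⱼ(x₀)ⱼ = 1`, `‖x - x₀‖ ≤ ε`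
and `‖φ - φ₀‖ ≤ ε`. -/
theorem bpb_l1_first_constructive
    (x : lp (fun _ : ℕ => ℂ) 1) (φ : lp (fun _ : ℕ => ℂ) ∞)
    (hx : ‖x‖ ≤ 1) (hφ : ‖φ‖ ≤ 1) (ε : ℝ) (hε0 : 0 < ε) (hε1 : ε < 1)
    (hpair : 1 - ε ^ 3 / 4 ≤ (∑' j : ℕ, φ j * x j).re)
    (P : Set ℕ) (hP : P = {j : ℕ | x j ≠ 0 ∧ (1 - ε ^ 2 / 2) * ‖x j‖ ≤ (φ j * x j).re})
    (M : ℝ) (hM : M = ∑' j : ℕ, P.indicator (fun j => ‖x j‖) j) :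
    ∃ (x₀ : lp (fun _ : ℕ => ℂ) 1) (φ₀ : lp (fun _ : ℕ => ℂ) ∞),
      (∀ j ∈ P, x₀ j = (M : ℂ)⁻¹ * x j) ∧ (∀ j ∉ P, x₀ j = 0) ∧
      (∀ j ∈ P, φ₀ j = Complex.exp (-(Complex.arg (x j)) * Complex.I)) ∧
      (∀ j ∉ P, φ₀ j = φ j) ∧
      ‖x₀‖ = 1 ∧ ‖φ₀‖ = 1 ∧ (∑' j : ℕ, φ₀ j * x₀ j) = 1 ∧
      ‖x - x₀‖ ≤ ε ∧ ‖φ - φ₀‖ ≤ ε := by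
  classical
  have hs := lp_one_summable_norm x
  have hsP : Summable fun j => P.indicator (fun j => ‖x j‖) j := hs.indicator P
  have hkey := tsum_norm_sub_indicator_le x φ hφ (ε ^ 2 / 2) P hP
  rw [← hM] at hkey
  have hMx : M ≤ ‖x‖ := by
    rw [hM, lp_one_norm_eq_tsum]
    exact hsP.tsum_le_tsum (fun j => Set.indicator_le_self' (fun _ _ => norm_nonneg _) j) hs
  have hdefect : 2 * (‖x‖ - M) + (1 - ‖x‖) ≤ ε := by
    have h1 : ε ^ 2 * (2 * (‖x‖ - M) + (1 - ‖x‖)) ≤ ε ^ 2 * ε := by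
      nlinarith [mul_nonneg (sub_nonneg.mpr hx) (by nlinarith : 0 ≤ 4 - ε ^ 2)]
    exact le_of_mul_le_mul_left h1 (by positivity)
  have hMpos : 0 < M := by linarith
  have hx₀norm : ∀ j, ‖P.indicator (fun j => (M : ℂ)⁻¹ * x j) j‖
      = M⁻¹ * P.indicator (fun j => ‖x j‖) j := fun j => by
    by_cases hj : j ∈ P <;> simp [hj, abs_of_pos hMpos]
  let x₀ : lp (fun _ : ℕ => ℂ) 1 := ⟨fun j => P.indicator (fun j => (M : ℂ)⁻¹ * x j) j, by
    refine memℓp_gen ?_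
    simpa [hx₀norm] using hsP.mul_left M⁻¹⟩
  have hphase : ∀ j, ‖if j ∈ P then Complex.exp (-(Complex.arg (x j)) * Complex.I) else φ j‖
      ≤ 1 := fun j => by
    split_ifs
    · exact (norm_exp_neg_arg _).le
    · exact (lp.norm_apply_le_norm ENNReal.top_ne_zero φ j).trans hφ
  let φ₀ : lp (fun _ : ℕ => ℂ) ∞ :=
    ⟨fun j => if j ∈ P then Complex.exp (-(Complex.arg (x j)) * Complex.I) else φ j,
      memℓp_infty ⟨1, by rintro _ ⟨j, rfl⟩; exact hphase j⟩⟩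
  have hx₀ : ∀ j, x₀ j = P.indicator (fun j => (M : ℂ)⁻¹ * x j) j := fun _ => rfl
  have hφ₀ : ∀ j, φ₀ j = if j ∈ P then Complex.exp (-(Complex.arg (x j)) * Complex.I) else φ j :=
    fun _ => rfl
  refine ⟨x₀, φ₀, fun j hj => by simp [hx₀, hj], fun j hj => by simp [hx₀, hj],
    fun j hj => by simp [hφ₀, hj], fun j hj => by simp [hφ₀, hj], ?_, ?_, ?_, ?_, ?_⟩
  · simp_rw [lp_one_norm_eq_tsum, hx₀, hx₀norm]
    rw [tsum_mul_left, ← hM, inv_mul_cancel₀ hMpos.ne']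
  · refine le_antisymm (lp.norm_le_of_forall_le zero_le_one hphase) ?_
    obtain ⟨j, hj⟩ : P.Nonempty := by
      by_contra hne
      rw [Set.not_nonempty_iff_eq_empty] at hne
      simp [hM, hne] at hMpos
    calc (1 : ℝ) = ‖φ₀ j‖ := by rw [hφ₀, if_pos hj, norm_exp_neg_arg]
      _ ≤ ‖φ₀‖ := lp.norm_apply_le_norm ENNReal.top_ne_zero φ₀ j
  · have hterm : ∀ j, φ₀ j * x₀ j = ((M⁻¹ * P.indicator (fun j => ‖x j‖) j : ℝ) : ℂ) := fun j => by
      by_cases hj : j ∈ P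
      · simp only [hφ₀, hx₀, hj, if_true, Set.indicator_of_mem]
        rw [mul_left_comm, exp_neg_arg_mul_self]
        simp
      · simp [hx₀, hj]
    simp_rw [hterm]
    rw [← Complex.ofReal_tsum, tsum_mul_left, ← hM, inv_mul_cancel₀ hMpos.ne', Complex.ofReal_one]
  · have hterm : ∀ j, ‖(x - x₀) j‖ = (‖x j‖ - P.indicator (fun j => ‖x j‖) j)
        + (M⁻¹ - 1) * P.indicator (fun j => ‖x j‖) j := fun j => by
      rw [lp.coeFn_sub, Pi.sub_apply, hx₀]
      by_cases hj : j ∈ P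
      · have hM1 : 0 ≤ M⁻¹ - 1 := sub_nonneg.mpr ((one_le_inv₀ hMpos).mpr (hMx.trans hx))
        have : x j - (M : ℂ)⁻¹ * x j = -((M⁻¹ - 1 : ℝ) * x j) := by push_cast; ring
        simp only [hj, Set.indicator_of_mem]
        rw [this, norm_neg, norm_mul, Complex.norm_of_nonneg hM1]
        ring
      · simp [hj]
    rw [lp_one_norm_eq_tsum]
    simp_rw [hterm]
    rw [(hs.sub hsP).tsum_add (hsP.mul_left _), hs.tsum_sub hsP, tsum_mul_left, ← hM,
      ← lp_one_norm_eq_tsum, sub_mul, inv_mul_cancel₀ hMpos.ne']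
    linarith
  · refine lp.norm_le_of_forall_le hε0.le fun j => ?_
    rw [lp.coeFn_sub, Pi.sub_apply, hφ₀]
    split_ifs with hj
    · rw [hP] at hj
      exact norm_sub_exp_neg_arg_le hε0.le hj.1
        ((lp.norm_apply_le_norm ENNReal.top_ne_zero φ j).trans hφ) hj.2
    · simpa using hε0.le
end

section
/- Let 0 < ε < 1 and let x ∈ ℓ₁ with ‖x‖ ≤ 1 and φ ∈ ℓ∞ with ‖φ‖ ≤ 1 be such that |∑ⱼ φⱼ xⱼ| ≥ 1 − ε³/4. Then there exist x₀ ∈ ℓ₁ and φ₀ ∈ ℓ∞ with ‖x₀‖ = ‖φ₀‖ = 1, ‖x − x₀‖ ≤ ε, ‖φ − φ₀‖ ≤ ε and |∑ⱼ (φ₀)ⱼ (x₀)ⱼ| = 1. -/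
open scoped ENNReal

theorem lp_one_hasSum_norm (x : lp (fun _ : ℕ => ℂ) 1) :
    HasSum (fun j => ‖x j‖) ‖x‖ := by
  simpa using lp.hasSum_norm (p := 1) (by simp) x

theorem memℓp_one_of_summable {f : ℕ → ℂ} (hf : Summable fun j => ‖f j‖) :
    Memℓp (E := fun _ : ℕ => ℂ) f 1 :=
  memℓp_gen (by simpa using hf)

theorem norm_sub_conj_div_le {a z : ℂ} {ε : ℝ} (hε : 0 ≤ ε) (ha : ‖a‖ ≤ 1) (hz : z ≠ 0)
    (h : (1 - ε ^ 2 / 2) * ‖z‖ ≤ (a * z).re) :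
    ‖a - (starRingEnd ℂ) z / ‖z‖‖ ≤ ε := by
  have hz' : 0 < ‖z‖ := norm_pos_iff.2 hz
  refine abs_le_of_sq_le_sq' ?_ hε |>.2
  set u : ℂ := (starRingEnd ℂ) z / ‖z‖ with hu
  have hun : ‖u‖ = 1 := by
    rw [hu, norm_div, RCLike.norm_conj, Complex.norm_real, norm_norm, div_self hz'.ne']
  have hre : (a * (starRingEnd ℂ) u).re = (a * z).re / ‖z‖ := by
    rw [hu, map_div₀, Complex.conj_conj, Complex.conj_ofReal, ← mul_div_assoc,
      Complex.div_ofReal_re]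
  have h1 : 1 - ε ^ 2 / 2 ≤ (a * (starRingEnd ℂ) u).re := by
    rw [hre, le_div_iff₀ hz']; exact h
  rw [← Complex.normSq_eq_norm_sq, Complex.normSq_sub, Complex.normSq_eq_norm_sq,
    Complex.normSq_eq_norm_sq, hun]
  nlinarith [norm_nonneg a]

/-- Bishop–Phelps–Bollobás theorem for `ℓ₁(ℂ)`: if `‖x‖ ≤ 1`, `‖φ‖ ≤ 1` and
`|∑ⱼ φⱼ xⱼ| ≥ 1 - ε³/4`, then there are `x₀`, `φ₀` of norm one with
`‖x - x₀‖ ≤ ε`, `‖φ - φ₀‖ ≤ ε` and `|∑ⱼ (φ₀)ⱼ (x₀)ⱼ| = 1`. -/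
theorem bpb_l1
    (ε : ℝ) (hε0 : 0 < ε) (hε1 : ε < 1)
    (x : lp (fun _ : ℕ => ℂ) 1) (φ : lp (fun _ : ℕ => ℂ) ∞)
    (hx : ‖x‖ ≤ 1) (hφ : ‖φ‖ ≤ 1)
    (hpair : 1 - ε ^ 3 / 4 ≤ ‖∑' j : ℕ, φ j * x j‖) :
    ∃ (x₀ : lp (fun _ : ℕ => ℂ) 1) (φ₀ : lp (fun _ : ℕ => ℂ) ∞),
      ‖x₀‖ = 1 ∧ ‖φ₀‖ = 1 ∧ ‖x - x₀‖ ≤ ε ∧ ‖φ - φ₀‖ ≤ ε ∧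
      ‖∑' j : ℕ, φ₀ j * x₀ j‖ = 1 := by
  classical
  have hφj : ∀ j, ‖φ j‖ ≤ 1 := fun j => (lp.norm_apply_le_norm (by simp) φ j).trans hφ
  have hX := lp_one_hasSum_norm x
  have hle : ∀ j, ‖φ j * x j‖ ≤ ‖x j‖ := fun j => by
    rw [norm_mul]
    exact mul_le_of_le_one_left (norm_nonneg _) (hφj j)
  have hsum : Summable fun j => φ j * x j := Summable.of_norm_bounded hX.summable hle
  have hε3 : ε ^ 3 < 1 := pow_lt_one₀ hε0.le hε1 (by norm_num)
  set S : ℂ := ∑' j : ℕ, φ j * x j with hS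
  have hSpos : 0 < ‖S‖ := by linarith
  obtain ⟨l, hl, hlS⟩ : ∃ l : ℂ, ‖l‖ = 1 ∧ l * S = ‖S‖ := by
    refine ⟨(starRingEnd ℂ) S / ‖S‖, ?_, ?_⟩
    · rw [norm_div, RCLike.norm_conj, Complex.norm_real, norm_norm, div_self hSpos.ne']
    · have : (‖S‖ : ℂ) ≠ 0 := by exact_mod_cast hSpos.ne'
      rw [div_mul_eq_mul_div, mul_comm, Complex.mul_conj, Complex.normSq_eq_norm_sq]
      field_simp
      push_cast; rfl
  have hl0 : l ≠ 0 := fun h => by simp [h] at hl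
  have hre : HasSum (fun j => (φ j * (l * x j)).re) ‖S‖ := by
    have h1 := Complex.hasSum_re (hsum.hasSum.mul_left l)
    rw [← hS, hlS, Complex.ofReal_re] at h1
    convert h1 using 3
    ring
  set A : Set ℕ := {j | x j ≠ 0 ∧ (1 - ε ^ 2 / 2) * ‖x j‖ ≤ (φ j * (l * x j)).re} with hA
  have hXA : Summable (A.indicator fun j => ‖x j‖) := hX.summable.indicator A
  set m : ℝ := ∑' j, A.indicator (fun j => ‖x j‖) j with hm
  have hAm : HasSum (A.indicator fun j => ‖x j‖) m := hXA.hasSum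
  have hdef : HasSum (fun j => ‖x j‖ - A.indicator (fun j => ‖x j‖) j) (‖x‖ - m) := hX.sub hAm
  have hkey : ε ^ 2 / 2 * (‖x‖ - m) ≤ ‖x‖ - ‖S‖ := by
    refine hasSum_le (fun j => ?_) (hdef.mul_left (ε ^ 2 / 2)) (hX.sub hre)
    have hb : (φ j * (l * x j)).re ≤ ‖x j‖ :=
      (Complex.re_le_norm _).trans (by simpa [norm_mul, hl] using hle j)
    by_cases hj : j ∈ A
    · simpa [hj] using hb
    · simp only [Set.indicator_of_notMem hj, sub_zero]
      by_cases h0 : x j = 0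
      · simp [h0]
      · have : ¬ (1 - ε ^ 2 / 2) * ‖x j‖ ≤ (φ j * (l * x j)).re := fun h => hj ⟨h0, h⟩
        linarith
  have hmx : m ≤ ‖x‖ := by
    have := hdef.nonneg fun j => sub_nonneg.2
      (Set.indicator_le_self' (fun _ _ => norm_nonneg (x _)) j)
    linarith
  have hfin : 2 * (‖x‖ - m) + (1 - ‖x‖) ≤ ε := by
    have h2 : 0 < ε ^ 2 := by positivity
    have h21 : ε ^ 2 < 1 := pow_lt_one₀ hε0.le hε1 (by norm_num)
    have : ε ^ 2 * (2 * (‖x‖ - m) + (1 - ‖x‖)) ≤ ε ^ 2 * ε := by nlinarith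
    exact le_of_mul_le_mul_left this h2
  have hmpos : 0 < m := by linarith
  obtain ⟨k, hk⟩ : A.Nonempty := by
    by_contra h
    rw [Set.not_nonempty_iff_eq_empty] at h
    simp [hm, h] at hmpos
  have hx0n : ∀ j, ‖A.indicator (fun j => x j / (m : ℂ)) j‖
      = A.indicator (fun j => ‖x j‖) j / m := fun j => by
    by_cases hj : j ∈ A <;> simp [hj, abs_of_pos hmpos]
  have hx0s : HasSum (fun j => ‖A.indicator (fun j => x j / (m : ℂ)) j‖) 1 := by
    simp_rw [hx0n]
    simpa [hmpos.ne'] using hAm.div_const m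
  set f : ℕ → ℂ := fun j =>
    if j ∈ A then (starRingEnd ℂ) (l * x j) / ‖l * x j‖ else φ j with hf
  have hfA : ∀ j ∈ A, ‖f j‖ = 1 := fun j hj => by
    have : ‖l * x j‖ ≠ 0 := norm_ne_zero_iff.2 (mul_ne_zero hl0 hj.1)
    simp only [hf, if_pos hj]
    rw [norm_div, RCLike.norm_conj, Complex.norm_real, norm_norm, div_self this]
  have hf1 : ∀ j, ‖f j‖ ≤ 1 := fun j => by
    by_cases hj : j ∈ A
    · exact (hfA j hj).le
    · simpa [hf, hj] using hφj j
  let x₀ : lp (fun _ : ℕ => ℂ) 1 :=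
    ⟨A.indicator fun j => x j / (m : ℂ), memℓp_one_of_summable hx0s.summable⟩
  let φ₀ : lp (fun _ : ℕ => ℂ) ∞ :=
    ⟨f, memℓp_infty ⟨1, by rintro _ ⟨j, rfl⟩; exact hf1 j⟩⟩
  refine ⟨x₀, φ₀, (lp_one_hasSum_norm x₀).unique hx0s, le_antisymm ?_ ?_, ?_, ?_, ?_⟩
  · exact lp.norm_le_of_forall_le zero_le_one hf1
  · rw [← hfA k hk]
    exact lp.norm_apply_le_norm (by simp) φ₀ k
  · refine le_trans (le_of_eq ?_) hfin
    refine (lp_one_hasSum_norm (x - x₀)).unique ?_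
    have h3 : HasSum (fun j => (‖x j‖ - A.indicator (fun j => ‖x j‖) j)
        + A.indicator (fun j => ‖x j‖) j * (1 / m - 1)) ((‖x‖ - m) + m * (1 / m - 1)) :=
      hdef.add (hAm.mul_right _)
    convert h3 using 1
    · ext j
      change ‖x j - A.indicator (fun j => x j / (m : ℂ)) j‖ = _
      by_cases hj : j ∈ A
      · have h4 : x j - x j / (m : ℂ) = -(x j * ((1 / m - 1 : ℝ) : ℂ)) := by
          push_cast; ring
        have h5 : 0 ≤ 1 / m - 1 := by
          rw [sub_nonneg, le_div_iff₀ hmpos]; linarith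
        simp only [Set.indicator_of_mem hj]
        rw [h4, norm_neg, norm_mul, Complex.norm_real, Real.norm_of_nonneg h5]
        ring
      · simp [hj]
    · field_simp
      ring
  · refine lp.norm_le_of_forall_le hε0.le fun j => ?_
    change ‖φ j - f j‖ ≤ ε
    by_cases hj : j ∈ A
    · simp only [hf, if_pos hj]
      refine norm_sub_conj_div_le hε0.le (hφj j) (mul_ne_zero hl0 hj.1) ?_
      rw [norm_mul, hl, one_mul]
      exact hj.2
    · simpa [hf, hj] using hε0.le
  · have h6 : HasSum (fun j => φ₀ j * x₀ j) ((starRingEnd ℂ) l) := by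
      have h7 := (Complex.hasSum_ofReal.2 (hAm.div_const m)).mul_left ((starRingEnd ℂ) l)
      rw [div_self hmpos.ne', Complex.ofReal_one, mul_one] at h7
      refine (funext fun j => ?_ : (fun j => φ₀ j * x₀ j) = _) ▸ h7
      change f j * A.indicator (fun j => x j / (m : ℂ)) j = _
      by_cases hj : j ∈ A
      · have h8 : (‖x j‖ : ℂ) ≠ 0 := by exact_mod_cast norm_ne_zero_iff.2 hj.1
        have h9 : (starRingEnd ℂ) (x j) * x j = (‖x j‖ : ℂ) ^ 2 := Complex.conj_mul' _
        simp only [hf, if_pos hj, Set.indicator_of_mem hj, norm_mul, hl, one_mul, map_mul,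
          Complex.ofReal_div]
        field_simp
        rw [mul_assoc, h9]
      · simp [hj]
    rw [h6.tsum_eq, RCLike.norm_conj, hl]
end

section
/- Let φ ∈ ℓ∞ with ‖φ‖ ≤ 1, let 0 < ε < 1, and define φ₀ ∈ ℓ∞ by (φ₀)ⱼ = e^{i·arg(φⱼ)} if |φⱼ| ≥ 1 − ε²/20 and (φ₀)ⱼ = φⱼ otherwise. Then every x ∈ ℓ₁ with ‖x‖ = 1 and ∑ⱼ φⱼ xⱼ = 1 also satisfies ∑ⱼ (φ₀)ⱼ xⱼ = 1; that is, π₁(φ) ⊆ π₁(φ₀). -/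
open scoped ENNReal

/-- If `∑ⱼ aⱼ xⱼ = ∑ⱼ ‖xⱼ‖` with `‖aⱼ‖ ≤ 1`, then `‖aⱼ‖ = 1` on the support of `x`. -/
theorem norm_eq_one_of_tsum_mul_eq_tsum_norm {ι : Type*} {a x : ι → ℂ} (ha : ∀ j, ‖a j‖ ≤ 1)
    (hx : Summable fun j => ‖x j‖) (h : ∑' j, a j * x j = ((∑' j, ‖x j‖ : ℝ) : ℂ))
    {j : ι} (hj : x j ≠ 0) : ‖a j‖ = 1 := by
  have hle : ∀ k, ‖a k * x k‖ ≤ ‖x k‖ := fun k => by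
    rw [norm_mul]
    exact mul_le_of_le_one_left (norm_nonneg _) (ha k)
  have hn : Summable fun k => ‖a k * x k‖ := Summable.of_nonneg_of_le (fun _ => norm_nonneg _) hle hx
  by_contra hne
  have hlt : ‖a j * x j‖ < ‖x j‖ := by
    rw [norm_mul]
    exact mul_lt_of_lt_one_left (norm_pos_iff.2 hj) (lt_of_le_of_ne (ha j) hne)
  have h₁ : ∑' k, ‖a k * x k‖ < ∑' k, ‖x k‖ := Summable.tsum_lt_tsum hle hlt hn hx
  have h₂ : ∑' k, ‖x k‖ ≤ ∑' k, ‖a k * x k‖ := by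
    calc ∑' k, ‖x k‖ ≤ ‖((∑' k, ‖x k‖ : ℝ) : ℂ)‖ := by
          rw [Complex.norm_real]; exact Real.le_norm_self _
      _ = ‖∑' k, a k * x k‖ := by rw [h]
      _ ≤ ∑' k, ‖a k * x k‖ := norm_tsum_le_tsum_norm hn
  exact absurd h₁ h₂.not_gt

/-- Let `‖φ‖ ≤ 1` in `ℓ∞(ℂ)`, `0 < ε < 1`, and let `φ₀` be defined by
`(φ₀)ⱼ = e^{i·arg(φⱼ)}` if `|φⱼ| ≥ 1 - ε²/20` and `(φ₀)ⱼ = φⱼ` otherwise.  Then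
`π₁(φ) ⊆ π₁(φ₀)`: every `x ∈ ℓ₁(ℂ)` with `‖x‖ = 1` and `∑ⱼ φⱼ xⱼ = 1` also
satisfies `∑ⱼ (φ₀)ⱼ xⱼ = 1`. -/
theorem pi_one_subset_pi_one
    (φ : lp (fun _ : ℕ => ℂ) ∞) (hφ : ‖φ‖ ≤ 1) (ε : ℝ) (hε0 : 0 < ε) (hε1 : ε < 1)
    (φ₀ : ℕ → ℂ)
    (hφ₀ : ∀ j : ℕ,
      φ₀ j = if 1 - ε ^ 2 / 20 ≤ ‖φ j‖ then Complex.exp (Complex.arg (φ j) * Complex.I)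
             else φ j)
    (x : lp (fun _ : ℕ => ℂ) 1) (hx : ‖x‖ = 1) (hx1 : (∑' j : ℕ, φ j * x j) = 1) :
    (∑' j : ℕ, φ₀ j * x j) = 1 := by
  have hn : HasSum (fun j => ‖x j‖) 1 := by
    simpa [hx] using lp.hasSum_norm (p := 1) (by simp) x
  rw [← hx1]
  refine tsum_congr fun j => ?_
  by_cases hj : x j = 0
  · simp [hj]
  have h1 : ‖φ j‖ = 1 :=
    norm_eq_one_of_tsum_mul_eq_tsum_norm
      (fun k => (lp.norm_apply_le_norm ENNReal.top_ne_zero φ k).trans hφ) hn.summable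
      (by rw [hx1, hn.tsum_eq, Complex.ofReal_one]) hj
  rw [hφ₀, if_pos (by rw [h1]; linarith [sq_nonneg ε])]
  congr 1
  simpa [h1] using Complex.norm_mul_exp_arg_mul_I (φ j)
end

section
/- Let T : ℓ₁ → ℓ₁ be a bounded linear operator with ‖T‖ = 1, let 0 < ε < 1, and let (x, φ) ∈ Π(ℓ₁) be such that Re(φ(Tx)) ≥ 1 − (ε/9)^{9/2}. Then there exist a bounded linear operator T₀ : ℓ₁ → ℓ₁ with ‖T₀‖ = 1 and a pair (x₀, φ₀) ∈ Π(ℓ₁) such that ‖T − T₀‖ ≤ ε, ‖x − x₀‖ ≤ ε, ‖φ − φ₀‖ ≤ ε, and φ₀(T₀ x₀) = 1. -/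
open scoped ENNReal

/-- The distance from `w` to `‖w‖` is controlled by the defect `‖w‖ - r * Re w`, `0 ≤ r ≤ 1`. -/
lemma Complex.norm_sub_norm_le_of_defect (w : ℂ) {r c : ℝ} (hr0 : 0 ≤ r) (hr1 : r ≤ 1)
    (hc : 0 < c) : ‖w - (‖w‖ : ℂ)‖ ≤ c * ‖w‖ + c⁻¹ * (‖w‖ - r * w.re) := by
  have hre : |w.re| ≤ ‖w‖ := Complex.abs_re_le_norm w
  obtain ⟨h1, h2⟩ := abs_le.1 hre
  have hn : 0 ≤ ‖w‖ := norm_nonneg w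
  have hd : 0 ≤ ‖w‖ - r * w.re := by
    nlinarith [mul_le_mul_of_nonneg_left h2 hr0]
  have hsq : ‖w - (‖w‖ : ℂ)‖ ^ 2 = 2 * ‖w‖ * (‖w‖ - w.re) := by
    have h := Complex.sq_norm w
    rw [Complex.sq_norm, Complex.normSq_apply]
    rw [Complex.normSq_apply] at h
    simp only [Complex.sub_re, Complex.sub_im, Complex.ofReal_re, Complex.ofReal_im]
    linear_combination -h
  have hdef : ‖w‖ - w.re ≤ 2 * (‖w‖ - r * w.re) := by
    rcases le_total 0 w.re with h | h <;> nlinarith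
  refine le_of_sq_le_sq ?_ (by positivity)
  have hcc : c * c⁻¹ = 1 := mul_inv_cancel₀ hc.ne'
  rw [hsq]
  calc 2 * ‖w‖ * (‖w‖ - w.re) ≤ 2 * ‖w‖ * (2 * (‖w‖ - r * w.re)) := by gcongr
    _ = 4 * (c * ‖w‖) * (c⁻¹ * (‖w‖ - r * w.re)) := by
      linear_combination (-4 * ‖w‖ * (‖w‖ - r * w.re)) * hcc
    _ ≤ _ := by nlinarith [sq_nonneg (c * ‖w‖ - c⁻¹ * (‖w‖ - r * w.re))]

namespace lp

lemma hasSum_norm_one (u : lp (fun _ : ℕ => ℂ) 1) : HasSum (fun k => ‖u k‖) ‖u‖ := by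
  simpa using lp.hasSum_norm (p := 1) (by simp) u

/-- A bounded sequence of vectors is the sequence of columns of an operator on `ℓ₁`. -/
lemma exists_clm_of_columns {E : Type*} [NormedAddCommGroup E] [NormedSpace ℂ E]
    [CompleteSpace E] (c : ℕ → E) {M : ℝ} (hM : 0 ≤ M) (hc : ∀ j, ‖c j‖ ≤ M) :
    ∃ L : lp (fun _ : ℕ => ℂ) 1 →L[ℂ] E,
      (∀ y, HasSum (fun j => y j • c j) (L y)) ∧ ‖L‖ ≤ M := by
  have hle (y : lp (fun _ : ℕ => ℂ) 1) (j : ℕ) : ‖y j • c j‖ ≤ ‖y j‖ * M := by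
    rw [norm_smul]
    gcongr
    exact hc j
  have hs (y : lp (fun _ : ℕ => ℂ) 1) : Summable (fun j => y j • c j) :=
    .of_norm_bounded ((hasSum_norm_one y).summable.mul_right M) (hle y)
  let L : lp (fun _ : ℕ => ℂ) 1 →ₗ[ℂ] E :=
    { toFun := fun y => ∑' j, y j • c j
      map_add' := fun y z => by
        rw [← (hs y).tsum_add (hs z)]
        simp [add_smul]
      map_smul' := fun a y => by
        rw [RingHom.id_apply, ← (hs y).tsum_const_smul]
        simp [mul_smul] }
  have hL (y : lp (fun _ : ℕ => ℂ) 1) : ‖L y‖ ≤ M * ‖y‖ := by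
    rw [mul_comm]
    exact tsum_of_norm_bounded ((hasSum_norm_one y).mul_right M) (hle y)
  exact ⟨L.mkContinuous M hL, fun y => (hs y).hasSum, L.mkContinuous_norm_le hM hL⟩

lemma hasSum_smul_map_single {E : Type*} [NormedAddCommGroup E] [NormedSpace ℂ E]
    (T : lp (fun _ : ℕ => ℂ) 1 →L[ℂ] E) (y : lp (fun _ : ℕ => ℂ) 1) :
    HasSum (fun j => y j • T (lp.single 1 j (1 : ℂ))) (T y) := by
  have h := (lp.hasSum_single (p := 1) (by simp) y).mapL T
  convert h using 2 with j
  rw [← map_smul, ← lp.single_smul, smul_eq_mul, mul_one]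

open ComplexConjugate in
/-- A vector of the unit ball of `ℓ₁` is close to a norm-one vector supported on `B` at which `ψ`
takes the value `1`. -/
lemma exists_support_eq_one (ψ : ℕ → ℂ) (hψ : ∀ k, ‖ψ k‖ ≤ 1) (B : Set ℕ)
    (hB : ∀ k ∈ B, ‖ψ k‖ = 1) {k₀ : ℕ} (hk₀ : k₀ ∈ B) (u : lp (fun _ : ℕ => ℂ) 1)
    (hu : ‖u‖ ≤ 1) {F : ℕ → ℝ} {S : ℝ} (hF : HasSum F S)
    (hFB : ∀ k ∈ B, ‖u k - conj (ψ k) * ‖u k‖‖ ≤ F k) (hFc : ∀ k ∉ B, 2 * ‖u k‖ ≤ F k) :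
    ∃ v : lp (fun _ : ℕ => ℂ) 1, (∀ k ∉ B, v k = 0) ∧ ‖v‖ = 1 ∧
      HasSum (fun k => ψ k * v k) 1 ∧ ‖u - v‖ ≤ S + (1 - ‖u‖) := by
  classical
  have hψψ (k) (hk : k ∈ B) : ψ k * conj (ψ k) = 1 := by
    rw [Complex.mul_conj, Complex.normSq_eq_norm_sq, hB k hk]
    simp
  let wf : ℕ → ℂ := fun k => if k ∈ B then conj (ψ k) * ‖u k‖ else 0
  have hwu (k) : ‖wf k‖ ≤ ‖u k‖ := by
    by_cases hk : k ∈ B <;> simp [wf, hk, hB]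
  have hwm : Memℓp wf 1 := by
    refine memℓp_gen ?_
    simpa using Summable.of_nonneg_of_le (fun k => norm_nonneg _) hwu
      (hasSum_norm_one u).summable
  let w : lp (fun _ : ℕ => ℂ) 1 := ⟨wf, hwm⟩
  have hw (k) : w k = wf k := rfl
  have hm : ‖w‖ ≤ 1 := (hasSum_le hwu (hasSum_norm_one w) (hasSum_norm_one u)).trans hu
  let e : lp (fun _ : ℕ => ℂ) 1 := lp.single 1 k₀ ((1 - ‖w‖ : ℝ) * conj (ψ k₀))
  have he : ‖e‖ = 1 - ‖w‖ := by
    simp only [e]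
    rw [lp.norm_single (by simp), norm_mul, RCLike.norm_conj, hB k₀ hk₀, mul_one,
      Complex.norm_real, Real.norm_of_nonneg (by linarith)]
  have hsw : HasSum (fun k => ψ k * w k) (‖w‖ : ℂ) := by
    have h := Complex.hasSum_ofReal.2 (hasSum_norm_one w)
    convert h using 2 with k
    by_cases hk : k ∈ B
    · simp [hw, wf, hk, hB k hk, ← mul_assoc, hψψ k hk]
    · simp [hw, wf, hk]
  have hse : HasSum (fun k => ψ k * e k) ((1 - ‖w‖ : ℝ) : ℂ) := by
    have h := hasSum_single (f := fun k => ψ k * e k) k₀ (fun k hk => by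
      simp [e, lp.single_apply, hk])
    have h0 : ψ k₀ * e k₀ = ((1 - ‖w‖ : ℝ) : ℂ) := by
      simp only [e, lp.single_apply_self]
      linear_combination ((1 - ‖w‖ : ℝ) : ℂ) * hψψ k₀ hk₀
    rwa [h0] at h
  have hsum : HasSum (fun k => ψ k * (w + e) k) 1 := by
    convert hsw.add hse using 1
    · funext k
      simp [mul_add]
    · push_cast
      ring
  refine ⟨w + e, fun k hk => ?_, le_antisymm ?_ ?_, hsum, ?_⟩
  · have hne : k ≠ k₀ := fun h => hk (h ▸ hk₀)
    simp [hw, wf, hk, e, lp.single_apply, hne]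
  · linarith [norm_add_le w e]
  · have h := tsum_of_norm_bounded (hasSum_norm_one (w + e)) (f := fun k => ψ k * (w + e) k)
      (fun k => by
        rw [norm_mul]
        exact mul_le_of_le_one_left (norm_nonneg _) (hψ k))
    rwa [hsum.tsum_eq, norm_one] at h
  · have h1 : ‖u - w‖ + ‖u‖ - ‖w‖ ≤ S := by
      refine hasSum_le (fun k => ?_)
        (((hasSum_norm_one (u - w)).add (hasSum_norm_one u)).sub (hasSum_norm_one w)) hF
      by_cases hk : k ∈ B
      · refine le_trans (le_of_eq ?_) (hFB k hk)
        simp [hw, wf, hk, hB k hk]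
      · refine le_trans (le_of_eq ?_) (hFc k hk)
        simp [hw, wf, hk]
        ring
    have h2 : ‖u - (w + e)‖ ≤ ‖u - w‖ + ‖e‖ := by
      rw [← sub_sub]
      exact norm_sub_le _ _
    linarith

end lp

/-- Bishop–Phelps–Bollobás type theorem for numerical radius on `ℓ₁(ℂ)`:
if `‖T‖ = 1`, `(x, φ) ∈ Π(ℓ₁)` and `Re(φ(Tx)) ≥ 1 - (ε/9)^{9/2}`, then there exist
`T₀` with `‖T₀‖ = 1` and `(x₀, φ₀) ∈ Π(ℓ₁)` with `‖T - T₀‖ ≤ ε`, `‖x - x₀‖ ≤ ε`,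
`‖φ - φ₀‖ ≤ ε` and `φ₀(T₀x₀) = 1`. -/
theorem bpb_numerical_radius_l1
    (T : lp (fun _ : ℕ => ℂ) 1 →L[ℂ] lp (fun _ : ℕ => ℂ) 1) (hT : ‖T‖ = 1)
    (ε : ℝ) (hε0 : 0 < ε) (hε1 : ε < 1)
    (x : lp (fun _ : ℕ => ℂ) 1) (φ : lp (fun _ : ℕ => ℂ) ∞)
    (hx : ‖x‖ = 1) (hφ : ‖φ‖ = 1) (hxφ : (∑' j : ℕ, φ j * x j) = 1)
    (hnum : 1 - (ε / 9) ^ ((9 : ℝ) / 2) ≤ (∑' j : ℕ, φ j * (T x) j).re) :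
    ∃ (T₀ : lp (fun _ : ℕ => ℂ) 1 →L[ℂ] lp (fun _ : ℕ => ℂ) 1)
      (x₀ : lp (fun _ : ℕ => ℂ) 1) (φ₀ : lp (fun _ : ℕ => ℂ) ∞),
      ‖T₀‖ = 1 ∧ ‖x₀‖ = 1 ∧ ‖φ₀‖ = 1 ∧ (∑' j : ℕ, φ₀ j * x₀ j) = 1 ∧
      ‖T - T₀‖ ≤ ε ∧ ‖x - x₀‖ ≤ ε ∧ ‖φ - φ₀‖ ≤ ε ∧
      (∑' j : ℕ, φ₀ j * (T₀ x₀) j) = 1 := by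
  classical
  have hδ : (ε / 9) ^ ((9 : ℝ) / 2) ≤ ε ^ 3 / 8 := by
    calc (ε / 9) ^ ((9 : ℝ) / 2) ≤ (ε / 9) ^ (3 : ℝ) :=
          Real.rpow_le_rpow_of_exponent_ge (by positivity) (by linarith) (by norm_num)
      _ = (ε / 9) ^ 3 := by norm_cast
      _ ≤ ε ^ 3 / 8 := by
        rw [div_pow]
        gcongr
        norm_num
  set η : ℝ := ε ^ 2 / 4 with hη
  have hη0 : 0 < η := by positivity
  have hφ1 (k) : ‖φ k‖ ≤ 1 := hφ ▸ lp.norm_apply_le_norm (by simp) φ k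
  obtain ⟨Φ, hΦ, hΦn⟩ := lp.exists_clm_of_columns (fun k => φ k) zero_le_one hφ1
  have hΦle (y) : ‖Φ y‖ ≤ ‖y‖ := by
    simpa using Φ.le_of_opNorm_le hΦn y
  let t : ℕ → lp (fun _ : ℕ => ℂ) 1 := fun j => T (lp.single 1 j (1 : ℂ))
  have ht (j) : ‖t j‖ ≤ 1 := by
    refine (T.le_opNorm _).trans ?_
    rw [hT, lp.norm_single (by simp)]
    simp
  have hTx : ∑' j : ℕ, φ j * (T x) j = Φ (T x) := by
    rw [← (hΦ (T x)).tsum_eq]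
    simp [mul_comm]
  have hΦx : Φ x = 1 := by
    rw [← hxφ, ← (hΦ x).tsum_eq]
    simp [mul_comm]
  rw [hTx] at hnum
  have hΦTx : HasSum (fun j => (x j * Φ (t j)).re) (Φ (T x)).re := by
    have h := Complex.hasSum_re ((lp.hasSum_smul_map_single T x).mapL Φ)
    simpa only [map_smul, smul_eq_mul] using h
  have hxnorm : HasSum (fun k => ‖x k‖) 1 := hx ▸ lp.hasSum_norm_one x
  -- Equality in `|φ(x)| ≤ ‖φ‖‖x‖` holds coordinatewise.
  have hle (k) : (x k * φ k).re ≤ ‖x k‖ := by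
    refine (Complex.re_le_norm _).trans ?_
    rw [norm_mul]
    exact mul_le_of_le_one_right (norm_nonneg _) (hφ1 k)
  have hre (k) : (x k * φ k).re = ‖x k‖ := by
    have h1 : HasSum (fun k => (x k * φ k).re) 1 := by
      have h := Complex.hasSum_re (hΦ x)
      rw [hΦx] at h
      simpa using h
    have h2 : HasSum (fun k => ‖x k‖ - (x k * φ k).re) 0 := by
      simpa using hxnorm.sub h1
    have h3 := congrFun ((hasSum_zero_iff_of_nonneg (fun k => sub_nonneg.2 (hle k))).1 h2) k
    simp only [Pi.zero_apply] at h3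
    linarith
  have hmul (k) : x k * φ k = ‖x k‖ := by
    have h1 : ‖x k * φ k‖ ≤ (x k * φ k).re := by
      rw [hre, norm_mul]
      exact mul_le_of_le_one_right (norm_nonneg _) (hφ1 k)
    have h2 : ‖x k * φ k‖ = (x k * φ k).re := le_antisymm h1 (Complex.re_le_norm _)
    have h3 := Complex.re_eq_norm.1 h2.symm
    rw [← hre k]
    exact (Complex.ext (by simp) (by simpa using h3.2.symm))
  let A : Set ℕ := {k | (1 - η) * ‖x k‖ < (x k * Φ (t k)).re}
  have hAφ (k) (hk : k ∈ A) : 0 < ‖x k‖ ∧ ‖φ k‖ = 1 := by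
    have hx0 : 0 < ‖x k‖ := by
      rw [norm_pos_iff]
      intro h
      simp [A, h] at hk
    refine ⟨hx0, ?_⟩
    have h := congrArg norm (hmul k)
    rw [norm_mul, Complex.norm_real, norm_norm] at h
    exact mul_left_cancel₀ hx0.ne' (h.trans (mul_one _).symm)
  have hconj (k) (hk : ‖φ k‖ = 1) : φ k * starRingEnd ℂ (φ k) = 1 := by
    rw [Complex.mul_conj, Complex.normSq_eq_norm_sq, hk]
    simp
  have hxk (k) (hk : ‖φ k‖ = 1) : x k = starRingEnd ℂ (φ k) * ‖x k‖ := by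
    linear_combination starRingEnd ℂ (φ k) * hmul k - x k * hconj k hk
  have hAη (j) (hj : j ∈ A) : 1 - η < (starRingEnd ℂ (φ j) * Φ (t j)).re := by
    obtain ⟨h0, h1⟩ := hAφ j hj
    have h2 : (1 - η) * ‖x j‖ < (x j * Φ (t j)).re := hj
    have h3 : x j * Φ (t j) = (‖x j‖ : ℂ) * (starRingEnd ℂ (φ j) * Φ (t j)) := by
      linear_combination Φ (t j) * hxk j h1
    rw [h3, Complex.re_ofReal_mul, mul_comm] at h2
    exact lt_of_mul_lt_mul_left h2 h0.le
  obtain ⟨k₀, hk₀⟩ : A.Nonempty := by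
    by_contra hA
    have h : ∀ k, (x k * Φ (t k)).re ≤ (1 - η) * ‖x k‖ := fun k =>
      not_lt.1 fun hk => hA ⟨k, hk⟩
    have h1 := hasSum_le h hΦTx (hxnorm.mul_left (1 - η))
    nlinarith [pow_pos hε0 2]
  obtain ⟨x₀, hx₀A, hx₀n, hx₀s, hx₀d⟩ := lp.exists_support_eq_one (fun k => φ k) hφ1 A
    (fun k hk => (hAφ k hk).2) hk₀ x hx.le ((hxnorm.sub hΦTx).mul_left (2 / η))
    (fun k hk => by
      rw [← hxk k (hAφ k hk).2, sub_self, norm_zero]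
      refine mul_nonneg (by positivity) (sub_nonneg.2 ((Complex.re_le_norm _).trans ?_))
      rw [norm_mul]
      exact mul_le_of_le_one_right (norm_nonneg _) ((hΦle _).trans (ht k)))
    (fun k hk => by
      have h : (x k * Φ (t k)).re ≤ (1 - η) * ‖x k‖ := not_lt.1 hk
      calc 2 * ‖x k‖ = 2 / η * (η * ‖x k‖) := by field_simp
        _ ≤ _ := by
          gcongr
          linarith)
  let B : Set ℕ := {k | 1 - ε ≤ ‖φ k‖}
  have hB0 (k) (hk : k ∈ B) : 0 < ‖φ k‖ := lt_of_lt_of_le (by linarith) hk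
  let ψ : ℕ → ℂ := fun k => if k ∈ B then φ k / ‖φ k‖ else φ k
  have hψB (k) (hk : k ∈ B) : ‖ψ k‖ = 1 := by
    simp [ψ, hk, (hB0 k hk).ne', -norm_eq_zero]
  have hψφ (k) (hk : k ∈ B) : φ k = ‖φ k‖ * ψ k := by
    have h : (‖φ k‖ : ℂ) ≠ 0 := by exact_mod_cast (hB0 k hk).ne'
    simp only [ψ, hk, if_true]
    field_simp
  have hψ1 (k) : ‖ψ k‖ ≤ 1 := by
    by_cases hk : k ∈ B
    · exact (hψB k hk).le
    · simpa [ψ, hk] using hφ1 k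
  have hAB (k) (hk : k ∈ A) : k ∈ B := by
    simp only [B, Set.mem_ofPred_eq, (hAφ k hk).2]
    linarith
  have hψA (k) (hk : k ∈ A) : ψ k = φ k := by
    simp [ψ, hAB k hk, (hAφ k hk).2]
  let φ₀ : lp (fun _ : ℕ => ℂ) ∞ := ⟨ψ, memℓp_infty ⟨1, by rintro _ ⟨k, rfl⟩; exact hψ1 k⟩⟩
  have hφ₀ (k) : φ₀ k = ψ k := rfl
  obtain ⟨Ψ, hΨ, hΨn⟩ := lp.exists_clm_of_columns ψ zero_le_one hψ1
  have hΨle (y) : ‖Ψ y‖ ≤ ‖y‖ := by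
    simpa using Ψ.le_of_opNorm_le hΨn y
  have hcol (j) : ∃ s : lp (fun _ : ℕ => ℂ) 1, ‖s‖ ≤ 1 ∧ ‖t j - s‖ ≤ ε ∧
      (j ∈ A → Ψ s = φ j) := by
    by_cases hj : j ∈ A
    swap
    · exact ⟨t j, ht j, by simpa using hε0.le, fun h => absurd h hj⟩
    set α : ℂ := starRingEnd ℂ (φ j) with hα
    have hαn : ‖α‖ = 1 := by rw [hα, RCLike.norm_conj, (hAφ j hj).2]
    have hαφ : φ j * α = 1 := hconj j (hAφ j hj).2
    have hun : ‖α • t j‖ = ‖t j‖ := by rw [norm_smul, hαn, one_mul]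
    have hsum : HasSum (fun k => ((α • t j) k * φ k).re) (α * Φ (t j)).re := by
      have h := Complex.hasSum_re (hΦ (α • t j))
      rwa [map_smul, smul_eq_mul] at h
    have hun' : HasSum (fun k => ‖(α • t j) k‖) ‖t j‖ := hun ▸ lp.hasSum_norm_one (α • t j)
    obtain ⟨v, -, hvn, hvs, hvd⟩ := lp.exists_support_eq_one ψ hψ1 B hψB (hAB k₀ hk₀)
      (α • t j) (hun.trans_le (ht j))
      ((hun'.mul_left (ε / 2)).add ((hun'.sub hsum).mul_left (ε / 2)⁻¹))
      (fun k hk => by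
        set z := (α • t j) k
        have hz : ‖z * ψ k‖ = ‖z‖ := by rw [norm_mul, hψB k hk, mul_one]
        have hψψ : ψ k * starRingEnd ℂ (ψ k) = 1 := by
          rw [Complex.mul_conj, Complex.normSq_eq_norm_sq, hψB k hk]
          simp
        have h := Complex.norm_sub_norm_le_of_defect (z * ψ k) (norm_nonneg (φ k)) (hφ1 k)
          (half_pos hε0)
        have h1 : ‖z - starRingEnd ℂ (ψ k) * ‖z‖‖ = ‖z * ψ k - (‖z‖ : ℂ)‖ := by
          rw [← mul_one ‖z - _‖, ← hψB k hk, ← norm_mul]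
          congr 1
          linear_combination (-(‖z‖ : ℂ)) * hψψ
        have h2 : (z * φ k).re = ‖φ k‖ * (z * ψ k).re := by
          rw [← Complex.re_ofReal_mul]
          congr 1
          linear_combination z * hψφ k hk
        rw [hz] at h
        rw [h1, h2]
        exact h)
      (fun k hk => by
        set z := (α • t j) k
        have hk' : ‖φ k‖ < 1 - ε := not_le.1 hk
        have h1 : (z * φ k).re ≤ ‖z‖ * (1 - ε) := by
          refine (Complex.re_le_norm _).trans ?_
          rw [norm_mul]
          gcongr
        calc 2 * ‖z‖ = 0 + (ε / 2)⁻¹ * (ε * ‖z‖) := by field_simp; ring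
          _ ≤ _ := by
            gcongr
            · positivity
            · linarith)
    have hΨv : Ψ v = 1 := by
      refine (hΨ v).unique ?_
      simpa only [smul_eq_mul, mul_comm] using hvs
    refine ⟨φ j • v, ?_, ?_, fun _ => ?_⟩
    · rw [norm_smul, (hAφ j hj).2, hvn, one_mul]
    · have h1 : ‖t j - φ j • v‖ = ‖α • t j - v‖ := by
        rw [← one_mul ‖α • t j - v‖, ← (hAφ j hj).2, ← norm_smul, smul_sub, smul_smul, hαφ,
          one_smul]
      rw [h1]
      refine hvd.trans ?_
      rw [hun]
      have h2 : (ε / 2)⁻¹ * (‖t j‖ - (α * Φ (t j)).re) ≤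
          (ε / 2)⁻¹ * (η - (1 - ‖t j‖)) :=
        mul_le_mul_of_nonneg_left (by linarith [hAη j hj]) (by positivity)
      have h3 : (ε / 2)⁻¹ * η = ε / 2 := by
        rw [hη]
        field_simp
        ring
      have h4 : 1 ≤ (ε / 2)⁻¹ := (one_le_inv₀ (by positivity)).2 (by linarith)
      have h5 := mul_le_mul_of_nonneg_right h4 (sub_nonneg.2 (ht j))
      have h6 := mul_le_mul_of_nonneg_left (ht j) (half_pos hε0).le
      rw [mul_sub _ η, h3] at h2
      linarith
    · rw [map_smul, hΨv, smul_eq_mul, mul_one]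
  choose s hs1 hs2 hs3 using hcol
  obtain ⟨T₀, hT₀, hT₀n⟩ := lp.exists_clm_of_columns s zero_le_one hs1
  obtain ⟨D, hD, hDn⟩ := lp.exists_clm_of_columns (fun j => t j - s j) hε0.le hs2
  have hTD : T - T₀ = D := by
    ext1 y
    refine HasSum.unique ?_ (hD y)
    simp only [smul_sub]
    exact (lp.hasSum_smul_map_single T y).sub (hT₀ y)
  have hx₀ψ : HasSum (fun j => x₀ j * ψ j) 1 := by
    convert hx₀s using 2 with j
    by_cases hj : j ∈ A
    · rw [hψA j hj, mul_comm]
    · simp [hx₀A j hj]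
  have hval : Ψ (T₀ x₀) = 1 := by
    refine HasSum.unique ((hT₀ x₀).mapL Ψ) ?_
    refine hx₀ψ.congr_fun fun j => ?_
    by_cases hj : j ∈ A
    · rw [map_smul, hs3 j hj, hψA j hj, smul_eq_mul]
    · simp [hx₀A j hj]
  refine ⟨T₀, x₀, φ₀, le_antisymm hT₀n ?_, hx₀n, le_antisymm ?_ ?_, ?_, hTD ▸ hDn, ?_, ?_, ?_⟩
  · calc (1 : ℝ) = ‖Ψ (T₀ x₀)‖ := by rw [hval, norm_one]
      _ ≤ ‖T₀ x₀‖ := hΨle _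
      _ ≤ ‖T₀‖ * ‖x₀‖ := T₀.le_opNorm _
      _ = ‖T₀‖ := by rw [hx₀n, mul_one]
  · exact lp.norm_le_of_forall_le zero_le_one hψ1
  · rw [← hψB k₀ (hAB k₀ hk₀)]
    exact lp.norm_apply_le_norm (by simp) φ₀ k₀
  · simpa only [hφ₀, mul_comm] using hx₀ψ.tsum_eq
  · refine hx₀d.trans ?_
    calc 2 / η * (1 - (Φ (T x)).re) + (1 - ‖x‖) ≤ 2 / η * (ε ^ 3 / 8) + (1 - ‖x‖) := by
          gcongr
          linarith
      _ = ε := by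
        rw [hx, hη]
        field_simp
        ring
  · refine lp.norm_le_of_forall_le hε0.le fun k => ?_
    change ‖φ k - ψ k‖ ≤ ε
    by_cases hk : k ∈ B
    · have h1 : φ k - ψ k = ((‖φ k‖ - 1 : ℝ) : ℂ) * ψ k := by
        push_cast
        linear_combination hψφ k hk
      have hk' : 1 - ε ≤ ‖φ k‖ := hk
      rw [h1, norm_mul, hψB k hk, mul_one, Complex.norm_real, Real.norm_eq_abs, abs_le]
      constructor <;> linarith [hφ1 k]
    · simpa [ψ, hk] using hε0.le
  · rw [← hval, ← (hΨ (T₀ x₀)).tsum_eq]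
    simp only [hφ₀, smul_eq_mul, mul_comm]
end

section
/- The space ℓ₁ has the Bishop-Phelps-Bollobás property for numerical radius: for every 0 < ε < 1 there exists δ > 0 such that whenever T : ℓ₁ → ℓ₁ is a bounded linear operator with ν(T) = 1 and (x, φ) ∈ Π(ℓ₁) satisfies |φ(Tx)| ≥ 1 − δ, there exist a bounded linear operator S : ℓ₁ → ℓ₁ with ν(S) = 1 and a pair (y, ψ) ∈ Π(ℓ₁) such that ν(T − S) ≤ ε, ‖x − y‖ ≤ ε, ‖φ − ψ‖ ≤ ε, and |ψ(Sy)| = 1. Moreover, since the numerical radius on ℓ₁ equals the operator norm, ν may be replaced by the operator norm throughout. -/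
open scoped ENNReal

/-- The numerical radius of a bounded linear operator on `ℓ₁(ℂ)`:
`ν(T) = sup {|φ(Tx)| : (x, φ) ∈ Π(ℓ₁)}`, where `ℓ∞(ℂ)` is the dual of `ℓ₁(ℂ)`
acting by `φ(x) = ∑ⱼ φⱼ xⱼ`. -/
noncomputable def l1NumRadius
    (T : lp (fun _ : ℕ => ℂ) 1 →L[ℂ] lp (fun _ : ℕ => ℂ) 1) : ℝ :=
  sSup {r : ℝ | ∃ (x : lp (fun _ : ℕ => ℂ) 1) (φ : lp (fun _ : ℕ => ℂ) ∞),
    ‖x‖ = 1 ∧ ‖φ‖ = 1 ∧ (∑' j : ℕ, φ j * x j) = 1 ∧ r = ‖∑' j : ℕ, φ j * (T x) j‖}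

/-- The complex sequence space `ℓ₁(ℂ)`. -/
noncomputable abbrev L1 := lp (fun _ : ℕ => ℂ) 1

namespace L1

/-- The `j`-th vector of the canonical basis of `ℓ₁(ℂ)`. -/
noncomputable def basisVec (j : ℕ) : L1 := lp.single 1 j (1 : ℂ)

lemma norm_basisVec (j : ℕ) : ‖basisVec j‖ = 1 := by
  rw [basisVec, lp.norm_single one_pos, norm_one]

lemma basisVec_apply (j k : ℕ) : basisVec j k = if k = j then 1 else 0 := by
  rw [basisVec, lp.single_apply, Pi.single_apply]

lemma hasSum_norm (x : L1) : HasSum (fun j => ‖x j‖) ‖x‖ := by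
  simpa using lp.hasSum_norm (p := 1) (by simp) x

lemma exists_of_summable {f : ℕ → ℂ} (hf : Summable fun j => ‖f j‖) :
    ∃ x : L1, ∀ j, x j = f j :=
  ⟨⟨f, memℓp_gen (by simpa using hf)⟩, fun _ => rfl⟩

lemma hasSum_smul_basisVec (x : L1) : HasSum (fun j => x j • basisVec j) x := by
  have h := lp.hasSum_single (p := 1) ENNReal.one_ne_top x
  refine h.congr_fun ?_
  intro j
  rw [basisVec, ← lp.single_smul, smul_eq_mul, mul_one]

lemma hasSum_map {E : Type*} [NormedAddCommGroup E] [NormedSpace ℂ E] (A : L1 →L[ℂ] E) (x : L1) :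
    HasSum (fun j => x j • A (basisVec j)) (A x) := by
  simpa using A.hasSum (hasSum_smul_basisVec x)

lemma summable_norm_smul {E : Type*} [NormedAddCommGroup E] [NormedSpace ℂ E]
    {c : ℕ → E} {C : ℝ} (hc : ∀ j, ‖c j‖ ≤ C) (x : L1) : Summable fun j => ‖x j • c j‖ := by
  refine Summable.of_nonneg_of_le (fun _ => norm_nonneg _) (fun j => ?_)
    ((hasSum_norm x).summable.mul_right C)
  rw [norm_smul]
  exact mul_le_mul_of_nonneg_left (hc j) (norm_nonneg _)

lemma norm_tsum_smul_le {E : Type*} [NormedAddCommGroup E] [NormedSpace ℂ E]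
    {c : ℕ → E} {C : ℝ} (hc : ∀ j, ‖c j‖ ≤ C) (x : L1) : ‖∑' j, x j • c j‖ ≤ C * ‖x‖ := by
  refine tsum_of_norm_bounded (g := fun j => C * ‖x j‖) ((hasSum_norm x).mul_left C) fun j => ?_
  rw [norm_smul, mul_comm]
  exact mul_le_mul_of_nonneg_right (hc j) (norm_nonneg _)

/-- A bounded sequence in a Banach space is the sequence of columns of an operator on `ℓ₁`. -/
lemma exists_map_basisVec {E : Type*} [NormedAddCommGroup E] [NormedSpace ℂ E] [CompleteSpace E]
    {c : ℕ → E} {C : ℝ} (hc : ∀ j, ‖c j‖ ≤ C) :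
    ∃ S : L1 →L[ℂ] E, ∀ j, S (basisVec j) = c j := by
  have hs := fun x => (summable_norm_smul hc x).of_norm
  let L : L1 →ₗ[ℂ] E :=
    { toFun := fun x => ∑' j, x j • c j
      map_add' := fun x y => by
        rw [← (hs x).tsum_add (hs y)]
        exact tsum_congr fun j => by simp [add_smul]
      map_smul' := fun a x => by
        rw [RingHom.id_apply, ← (hs x).tsum_const_smul a]
        exact tsum_congr fun j => by simp [mul_smul] }
  refine ⟨L.mkContinuous C (norm_tsum_smul_le hc), fun j => ?_⟩
  change ∑' k, basisVec j k • c k = c j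
  rw [tsum_eq_single j]
  · simp [basisVec_apply]
  · intro k hk
    simp [basisVec_apply, hk]

lemma opNorm_le {E : Type*} [NormedAddCommGroup E] [NormedSpace ℂ E] (A : L1 →L[ℂ] E) {C : ℝ}
    (hC : 0 ≤ C) (h : ∀ j, ‖A (basisVec j)‖ ≤ C) : ‖A‖ ≤ C := by
  refine A.opNorm_le_bound hC fun x => ?_
  rw [← (hasSum_map A x).tsum_eq]
  exact norm_tsum_smul_le h x

lemma summable_pairing {φ : ℕ → ℂ} {C : ℝ} (hφ : ∀ j, ‖φ j‖ ≤ C) (x : L1) :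
    Summable fun j => φ j * x j := by
  simpa [mul_comm] using (summable_norm_smul hφ x).of_norm

lemma norm_pairing_le {φ : ℕ → ℂ} (hφ : ∀ j, ‖φ j‖ ≤ 1) (x : L1) :
    ‖∑' j, φ j * x j‖ ≤ ‖x‖ := by
  simpa [mul_comm] using norm_tsum_smul_le hφ x

lemma hasSum_pairing_map {φ : ℕ → ℂ} {C : ℝ} (hφ : ∀ j, ‖φ j‖ ≤ C) (T : L1 →L[ℂ] L1) (x : L1) :
    HasSum (fun j => x j * ∑' k, φ k * T (basisVec j) k) (∑' k, φ k * T x k) := by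
  obtain ⟨P, hP⟩ := exists_map_basisVec hφ
  have hP' : ∀ z : L1, P z = ∑' k, φ k * z k := fun z => by
    rw [← (hasSum_map P z).tsum_eq]
    exact tsum_congr fun k => by rw [hP, smul_eq_mul, mul_comm]
  simpa [hP'] using hasSum_map (P.comp T) x

end L1

open L1

lemma norm_apply_le_of_norm_le {φ : lp (fun _ : ℕ => ℂ) ∞} (hφ : ‖φ‖ ≤ 1) (j : ℕ) :
    ‖φ j‖ ≤ 1 :=
  (lp.norm_apply_le_norm ENNReal.top_ne_zero φ j).trans hφ

lemma exists_lpInfty {f : ℕ → ℂ} {C : ℝ} (hf : ∀ j, ‖f j‖ ≤ C) :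
    ∃ φ : lp (fun _ : ℕ => ℂ) ∞, ∀ j, φ j = f j :=
  ⟨⟨f, memℓp_infty ⟨C, by rintro _ ⟨j, rfl⟩; exact hf j⟩⟩, fun _ => rfl⟩

lemma l1NumRadius_set_le (T : L1 →L[ℂ] L1) {r : ℝ}
    (hr : ∃ (x : L1) (φ : lp (fun _ : ℕ => ℂ) ∞), ‖x‖ = 1 ∧ ‖φ‖ = 1 ∧
      (∑' j : ℕ, φ j * x j) = 1 ∧ r = ‖∑' j : ℕ, φ j * (T x) j‖) : r ≤ ‖T‖ := by
  obtain ⟨x, φ, hx, hφ, -, rfl⟩ := hr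
  refine (norm_pairing_le (norm_apply_le_of_norm_le hφ.le) _).trans ?_
  simpa [hx] using T.le_opNorm x

lemma l1NumRadius_le_norm (T : L1 →L[ℂ] L1) : l1NumRadius T ≤ ‖T‖ :=
  Real.sSup_le (fun _ hr => l1NumRadius_set_le T hr) (norm_nonneg _)

lemma le_l1NumRadius (T : L1 →L[ℂ] L1) {x : L1} {φ : lp (fun _ : ℕ => ℂ) ∞} (hx : ‖x‖ = 1)
    (hφ : ‖φ‖ = 1) (h : (∑' j : ℕ, φ j * x j) = 1) :
    ‖∑' j : ℕ, φ j * (T x) j‖ ≤ l1NumRadius T :=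
  le_csSup ⟨‖T‖, fun _ hr => l1NumRadius_set_le T hr⟩ ⟨x, φ, hx, hφ, h, rfl⟩

lemma exists_norm_eq_one_mul_eq_norm (z : ℂ) : ∃ α : ℂ, ‖α‖ = 1 ∧ α * z = ‖z‖ := by
  by_cases hz : z = 0
  · exact ⟨1, by simp, by simp [hz]⟩
  · have hz' : (‖z‖ : ℂ) ≠ 0 := by simpa using hz
    refine ⟨(starRingEnd ℂ) z / ‖z‖, by simp [hz], ?_⟩
    rw [div_mul_eq_mul_div, Complex.conj_mul']
    field_simp

lemma norm_map_basisVec_le (T : L1 →L[ℂ] L1) (j : ℕ) : ‖T (basisVec j)‖ ≤ l1NumRadius T := by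
  set t := T (basisVec j)
  choose α hα hαt using fun k => exists_norm_eq_one_mul_eq_norm (t k)
  have hj : α j ≠ 0 := fun h => by simpa [h] using hα j
  have hb : ∀ k, ‖α k / α j‖ ≤ 1 := fun k => by simp [hα]
  obtain ⟨φ, hφ⟩ := exists_lpInfty hb
  have hφ1 : ‖φ‖ = 1 := by
    refine le_antisymm (lp.norm_le_of_forall_le zero_le_one fun k => by rw [hφ]; exact hb k) ?_
    refine le_trans ?_ (lp.norm_apply_le_norm ENNReal.top_ne_zero φ j)
    simp [hφ, hj]
  have h1 : ∑' k, φ k * basisVec j k = 1 := by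
    rw [tsum_eq_single j]
    · simp [basisVec_apply, hφ, hj]
    · intro k hk
      simp [basisVec_apply, hk]
  refine le_trans (le_of_eq ?_) (le_l1NumRadius T (norm_basisVec j) hφ1 h1)
  have h2 : HasSum (fun k => φ k * t k) ((α j)⁻¹ * ‖t‖) := by
    refine HasSum.congr_fun ((Complex.hasSum_ofReal.2 (hasSum_norm t)).mul_left _) fun k => ?_
    rw [hφ, ← hαt]
    ring
  rw [h2.tsum_eq]
  simp [hα]

lemma norm_sub_ofReal_norm_le {a d : ℝ} (ha : 0 < a) (w : ℂ) (hd : ‖w‖ - w.re ≤ 2 * d) (hd0 : 0 ≤ d) :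
    ‖w - (‖w‖ : ℂ)‖ ≤ a * ‖w‖ + d / a := by
  have hw := norm_nonneg w
  have h1 : ‖w - (‖w‖ : ℂ)‖ ^ 2 = 2 * ‖w‖ * (‖w‖ - w.re) := by
    have h2 := Complex.sq_norm w
    rw [Complex.normSq_apply] at h2
    rw [Complex.sq_norm, Complex.normSq_apply]
    simp only [Complex.sub_re, Complex.ofReal_re, Complex.sub_im, Complex.ofReal_im, sub_zero]
    linarith
  refine le_of_sq_le_sq ?_ (by positivity)
  have h3 : (a * ‖w‖ + d / a) ^ 2 = (a * ‖w‖ - d / a) ^ 2 + 4 * ‖w‖ * d := by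
    field_simp
    ring
  rw [h1, h3]
  nlinarith [sq_nonneg (a * ‖w‖ - d / a), mul_le_mul_of_nonneg_left hd hw]

/-- Normalises the entries of `φ` whose modulus is at least `1 - a`. -/
noncomputable def normalizeLarge (a : ℝ) (φ : ℕ → ℂ) (k : ℕ) : ℂ :=
  if 1 - a ≤ ‖φ k‖ then φ k / ‖φ k‖ else φ k

section normalizeLarge

variable {a : ℝ} {φ : ℕ → ℂ}

lemma normalizeLarge_of_norm_eq_one (ha : 0 < a) {k : ℕ} (hk : ‖φ k‖ = 1) :
    normalizeLarge a φ k = φ k := by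
  simp [normalizeLarge, hk, ha.le]

lemma norm_normalizeLarge_of_le (ha1 : a < 1) {k : ℕ} (hk : 1 - a ≤ ‖φ k‖) :
    ‖normalizeLarge a φ k‖ = 1 := by
  have h : ‖φ k‖ ≠ 0 := by linarith
  simp [normalizeLarge, hk, h]

lemma norm_mul_normalizeLarge (ha1 : a < 1) {k : ℕ} (hk : 1 - a ≤ ‖φ k‖) :
    ‖φ k‖ * normalizeLarge a φ k = φ k := by
  have h : (‖φ k‖ : ℂ) ≠ 0 := by
    have : ‖φ k‖ ≠ 0 := by linarith
    exact_mod_cast this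
  rw [normalizeLarge, if_pos hk]
  field_simp

lemma norm_normalizeLarge_le (ha1 : a < 1) (hφ : ∀ k, ‖φ k‖ ≤ 1) (k : ℕ) :
    ‖normalizeLarge a φ k‖ ≤ 1 := by
  by_cases hk : 1 - a ≤ ‖φ k‖
  · exact (norm_normalizeLarge_of_le ha1 hk).le
  · rw [normalizeLarge, if_neg hk]
    exact hφ k

lemma norm_sub_normalizeLarge_le (ha : 0 < a) (ha1 : a < 1) (hφ : ∀ k, ‖φ k‖ ≤ 1) (k : ℕ) :
    ‖φ k - normalizeLarge a φ k‖ ≤ a := by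
  by_cases hk : 1 - a ≤ ‖φ k‖
  · have h : φ k - normalizeLarge a φ k = ((‖φ k‖ - 1 : ℝ) : ℂ) * normalizeLarge a φ k := by
      push_cast
      linear_combination -norm_mul_normalizeLarge ha1 hk
    rw [h, norm_mul, norm_normalizeLarge_of_le ha1 hk, Complex.norm_real, mul_one,
      Real.norm_eq_abs, abs_le]
    constructor <;> linarith [hφ k]
  · rw [normalizeLarge, if_neg hk, sub_self, norm_zero]
    exact ha.le

lemma norm_sub_column_le (ha : 0 < a) (ha1 : a < 1) {k : ℕ} (hφ : ‖φ k‖ ≤ 1) {β : ℂ}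
    (hβ : ‖β‖ = 1) (t : ℂ) :
    ‖t - if 1 - a ≤ ‖φ k‖ then (starRingEnd ℂ) (β * normalizeLarge a φ k) * ‖t‖ else 0‖ ≤
      a * ‖t‖ + (‖t‖ - (β * (φ k * t)).re) / a := by
  have ht := norm_nonneg t
  have hre : (β * (φ k * t)).re ≤ ‖φ k‖ * ‖t‖ := by
    refine (Complex.re_le_norm _).trans ?_
    simp [hβ]
  split_ifs with hk
  · set u := β * normalizeLarge a φ k with hu
    have hu1 : ‖u‖ = 1 := by rw [hu, norm_mul, hβ, norm_normalizeLarge_of_le ha1 hk, one_mul]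
    have huu : u * (starRingEnd ℂ) u = 1 := by rw [Complex.mul_conj', hu1]; simp
    have hw : ‖u * t‖ = ‖t‖ := by rw [norm_mul, hu1, one_mul]
    have h1 : ‖t - (starRingEnd ℂ) u * ‖t‖‖ = ‖u * t - (‖u * t‖ : ℂ)‖ := by
      rw [hw, ← one_mul ‖t - _‖, ← hu1, ← norm_mul, mul_sub, ← mul_assoc, huu, one_mul]
    have h2 : (β * (φ k * t)).re = ‖φ k‖ * (u * t).re := by
      rw [← Complex.re_ofReal_mul]
      congr 1
      rw [hu]
      linear_combination β * t * (norm_mul_normalizeLarge ha1 hk).symm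
    have hr0 := norm_nonneg (φ k)
    have h3 := Complex.re_le_norm (u * t)
    have h4 := (abs_le.1 (Complex.abs_re_le_norm (u * t))).1
    rw [hw] at h3 h4
    rw [h1]
    refine (norm_sub_ofReal_norm_le ha (u * t) (d := ‖t‖ - (β * (φ k * t)).re) ?_ ?_).trans_eq (by rw [hw])
    · rw [h2, hw]
      rcases le_total 0 (u * t).re with h | h
      · nlinarith
      · nlinarith
    · nlinarith
  · push Not at hk
    rw [sub_zero]
    have h1 : ‖t‖ ≤ (‖t‖ - (β * (φ k * t)).re) / a := by
      rw [le_div_iff₀ ha]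
      nlinarith
    nlinarith

/-- A column on which `φ` almost attains its norm is close to one on which `normalizeLarge a φ`
attains its norm. -/
lemma exists_column (ha : 0 < a) (ha1 : a < 1) (hφ : ∀ k, ‖φ k‖ ≤ 1) {j : ℕ} (hj : ‖φ j‖ = 1)
    {β : ℂ} (hβ : ‖β‖ = 1) {t : L1} (ht : ‖t‖ ≤ 1) {η : ℝ}
    (h : 1 - η ≤ (β * ∑' k, φ k * t k).re) :
    ∃ s : L1, ‖s‖ ≤ 1 ∧ β * ∑' k, normalizeLarge a φ k * s k = 1 ∧
      ‖t - s‖ ≤ 2 * (a + η / a) + η := by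
  set ψ := normalizeLarge a φ with hψ
  have hψ1 : ∀ k, ‖ψ k‖ ≤ 1 := norm_normalizeLarge_le ha1 hφ
  let f : ℕ → ℂ := fun k => if 1 - a ≤ ‖φ k‖ then (starRingEnd ℂ) (β * ψ k) * ‖t k‖ else 0
  have hf : ∀ k, ‖f k‖ ≤ ‖t k‖ := fun k => by
    by_cases hk : 1 - a ≤ ‖φ k‖
    · simp only [f, if_pos hk]
      simp [hβ, hψ, norm_normalizeLarge_of_le ha1 hk]
    · simp only [f, if_neg hk]
      simp
  obtain ⟨s, hs⟩ := exists_of_summable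
    (Summable.of_nonneg_of_le (fun _ => norm_nonneg _) hf (hasSum_norm t).summable)
  have hst : ‖s‖ ≤ ‖t‖ :=
    hasSum_le (fun k => by rw [hs]; exact hf k) (hasSum_norm s) (hasSum_norm t)
  have hpair : HasSum (fun k => β * (φ k * t k)) (β * ∑' k, φ k * t k) :=
    (summable_pairing hφ t).hasSum.mul_left β
  have hre := Complex.hasSum_re hpair
  have hdist : ‖t - s‖ ≤ a * ‖t‖ + (‖t‖ - (β * ∑' k, φ k * t k).re) / a := by
    refine hasSum_le (fun k => ?_) (hasSum_norm (t - s))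
      (((hasSum_norm t).mul_left a).add (((hasSum_norm t).sub hre).div_const a))
    rw [lp.coeFn_sub, Pi.sub_apply, hs]
    exact norm_sub_column_le ha ha1 (hφ k) hβ (t k)
  have hdist' : ‖t - s‖ ≤ a + η / a := by
    refine hdist.trans (add_le_add ?_ ?_)
    · nlinarith
    · gcongr
      linarith
  have hnt : 1 - η ≤ ‖t‖ := by
    refine h.trans ((Complex.re_le_norm _).trans ?_)
    rw [norm_mul, hβ, one_mul]
    exact norm_pairing_le hφ t
  have hpairs : β * ∑' k, ψ k * s k = ‖s‖ := by
    rw [← tsum_mul_left]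
    refine (HasSum.congr_fun (Complex.hasSum_ofReal.2 (hasSum_norm s)) fun k => ?_).tsum_eq
    rw [hs]
    by_cases hk : 1 - a ≤ ‖φ k‖
    · have hu1 : ‖β * ψ k‖ = 1 := by
        rw [norm_mul, hβ, hψ, norm_normalizeLarge_of_le ha1 hk, one_mul]
      simp only [f, if_pos hk]
      rw [norm_mul, RCLike.norm_conj, hu1, one_mul, ← mul_assoc, ← mul_assoc, Complex.mul_conj',
        hu1]
      simp
    · simp only [f, if_neg hk]
      simp
  have hψj : ψ j = φ j := normalizeLarge_of_norm_eq_one ha hj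
  set c : ℂ := (starRingEnd ℂ) (β * φ j) * ((1 - ‖s‖ : ℝ) : ℂ) with hc
  have hcn : ‖c‖ = 1 - ‖s‖ := by
    rw [hc, norm_mul, RCLike.norm_conj, norm_mul, hβ, hj, Complex.norm_real, Real.norm_eq_abs,
      abs_of_nonneg (by linarith)]
    ring
  have hcb : ‖c • basisVec j‖ = 1 - ‖s‖ := by rw [norm_smul, norm_basisVec, hcn, mul_one]
  refine ⟨s + c • basisVec j, ?_, ?_, ?_⟩
  · refine (norm_add_le _ _).trans ?_
    rw [hcb]
    linarith
  · have h1 : HasSum (fun k => ψ k * (c • basisVec j : L1) k) (ψ j * c) := by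
      have h0 : ψ j * c = ψ j * (c • basisVec j : L1) j := by simp [basisVec_apply]
      rw [h0]
      exact hasSum_single j fun k hk => by simp [basisVec_apply, hk]
    have h2 := (summable_pairing hψ1 s).hasSum.add h1
    have h3 : ∑' k, ψ k * (s + c • basisVec j : L1) k = ∑' k, ψ k * s k + ψ j * c := by
      rw [← h2.tsum_eq]
      exact tsum_congr fun k => by rw [lp.coeFn_add, Pi.add_apply, mul_add]
    have h4 : β * φ j * (starRingEnd ℂ) (β * φ j) = 1 := by
      rw [Complex.mul_conj', norm_mul, hβ, hj]
      simp
    rw [h3, mul_add, hpairs, hψj, hc]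
    push_cast
    linear_combination (1 - (‖s‖ : ℂ)) * h4
  · have h1 : ‖t - (s + c • basisVec j)‖ ≤ ‖t - s‖ + ‖c • basisVec j‖ := by
      rw [← sub_sub]
      exact norm_sub_le _ _
    have h2 := _root_.norm_sub_norm_le t s
    linarith

end normalizeLarge

lemma mul_eq_norm_of_pairing_eq_one {φ : ℕ → ℂ} (hφ : ∀ k, ‖φ k‖ ≤ 1) {x : L1} (hx : ‖x‖ = 1)
    (h : ∑' k, φ k * x k = 1) (j : ℕ) : φ j * x j = ‖x j‖ := by
  have hle : ∀ k, ‖φ k * x k‖ ≤ ‖x k‖ := fun k => by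
    rw [norm_mul]
    exact mul_le_of_le_one_left (norm_nonneg _) (hφ k)
  have h1 := Complex.hasSum_re (summable_pairing hφ x).hasSum
  rw [h, Complex.one_re] at h1
  have h2 := (hasSum_norm x).sub h1
  rw [hx, sub_self] at h2
  have h3 := (hasSum_zero_iff_of_nonneg
    fun k => sub_nonneg.2 ((Complex.re_le_norm _).trans (hle k))).1 h2
  have h4 : ‖x j‖ - (φ j * x j).re = 0 := congrFun h3 j
  have h5 : (φ j * x j).re = ‖φ j * x j‖ := le_antisymm (Complex.re_le_norm _) (by linarith [hle j])
  have h6 := Complex.re_eq_norm.1 h5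
  rw [Complex.eq_re_of_ofReal_le h6]
  congr 1
  linarith

/-- A unit vector of `ℓ₁` with most of its mass on `J` is close to a unit vector supported on
`J`. -/
lemma exists_normalized_restrict {x : L1} (hx : ‖x‖ = 1) (J : Set ℕ) {ε : ℝ} (hε : ε < 1)
    (h : 1 - ε / 2 ≤ ∑' j, J.indicator (fun j => ‖x j‖) j) :
    ∃ (y : L1) (m : ℝ), 0 < m ∧ ‖y‖ = 1 ∧ ‖x - y‖ ≤ ε ∧ (∀ j ∈ J, y j = m * x j) ∧
      ∀ j ∉ J, y j = 0 := by
  classical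
  set M := ∑' j, J.indicator (fun j => ‖x j‖) j with hM
  have hsum : HasSum (J.indicator fun j => ‖x j‖) M := ((hasSum_norm x).summable.indicator J).hasSum
  have hM0 : 0 < M := by linarith
  have hM1 : M ≤ 1 := by
    rw [← hx]
    exact hasSum_le (fun j => Set.indicator_le_self' (fun _ _ => norm_nonneg _) j) hsum
      (hasSum_norm x)
  have hfn : HasSum (fun j => ‖J.indicator (fun j => ((M⁻¹ : ℝ) : ℂ) * x j) j‖) 1 := by
    have h1 := hsum.mul_left M⁻¹
    rw [inv_mul_cancel₀ hM0.ne'] at h1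
    refine h1.congr_fun fun j => ?_
    by_cases hj : j ∈ J
    · simp [hj, abs_of_pos hM0]
    · simp [hj]
  obtain ⟨y, hy⟩ := exists_of_summable hfn.summable
  refine ⟨y, M⁻¹, inv_pos.2 hM0, ?_, ?_, fun j hj => by simp [hy, hj], fun j hj => by simp [hy, hj]⟩
  · refine (hasSum_norm y).unique ?_
    simpa only [hy] using hfn
  · have h2 : HasSum (fun j => ‖x j‖ + (M⁻¹ - 2) * J.indicator (fun j => ‖x j‖) j)
        (‖x‖ + (M⁻¹ - 2) * M) := (hasSum_norm x).add (hsum.mul_left _)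
    have h3 : ‖x - y‖ ≤ ‖x‖ + (M⁻¹ - 2) * M := by
      refine hasSum_le (fun j => ?_) (hasSum_norm (x - y)) h2
      rw [lp.coeFn_sub, Pi.sub_apply, hy]
      by_cases hj : j ∈ J
      · have h4 : x j - ((M⁻¹ : ℝ) : ℂ) * x j = ((1 - M⁻¹ : ℝ) : ℂ) * x j := by push_cast; ring
        have h5 : 1 ≤ M⁻¹ := (one_le_inv₀ hM0).2 hM1
        rw [Set.indicator_of_mem hj, Set.indicator_of_mem hj, h4, norm_mul, Complex.norm_real,
          Real.norm_eq_abs, abs_of_nonpos (by linarith)]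
        linarith
      · simp [hj]
    have h6 : (M⁻¹ - 2) * M = 1 - 2 * M := by field_simp
    rw [hx, h6] at h3
    linarith

/-- `ℓ₁(ℂ)` has the Bishop–Phelps–Bollobás property for numerical radius. -/
theorem bpb_property_numerical_radius_l1 :
    ∀ ε : ℝ, 0 < ε → ε < 1 → ∃ δ : ℝ, 0 < δ ∧
      ∀ (T : lp (fun _ : ℕ => ℂ) 1 →L[ℂ] lp (fun _ : ℕ => ℂ) 1)
        (x : lp (fun _ : ℕ => ℂ) 1) (φ : lp (fun _ : ℕ => ℂ) ∞),
        l1NumRadius T = 1 →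
        ‖x‖ = 1 → ‖φ‖ = 1 → (∑' j : ℕ, φ j * x j) = 1 →
        1 - δ ≤ ‖∑' j : ℕ, φ j * (T x) j‖ →
        ∃ (S : lp (fun _ : ℕ => ℂ) 1 →L[ℂ] lp (fun _ : ℕ => ℂ) 1)
          (y : lp (fun _ : ℕ => ℂ) 1) (ψ : lp (fun _ : ℕ => ℂ) ∞),
          l1NumRadius S = 1 ∧ ‖y‖ = 1 ∧ ‖ψ‖ = 1 ∧ (∑' j : ℕ, ψ j * y j) = 1 ∧
          l1NumRadius (T - S) ≤ ε ∧ ‖x - y‖ ≤ ε ∧ ‖φ - ψ‖ ≤ ε ∧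
          ‖∑' j : ℕ, ψ j * (S y) j‖ = 1 := by
  intro ε hε hε1
  set a := ε / 8 with ha
  set η := ε ^ 2 / 64 with hη
  have ha0 : 0 < a := by positivity
  have ha1 : a < 1 := by linarith
  have hη0 : 0 < η := by positivity
  refine ⟨η * (ε / 2), by positivity, fun T x φ hT hx hφ hφx hTx => ?_⟩
  have hφ1 : ∀ k, ‖φ k‖ ≤ 1 := norm_apply_le_of_norm_le hφ.le
  have hTb : ∀ j, ‖T (basisVec j)‖ ≤ 1 := fun j => hT ▸ norm_map_basisVec_le T j
  obtain ⟨α, hα, hαT⟩ := exists_norm_eq_one_mul_eq_norm (∑' j : ℕ, φ j * (T x) j)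
  set g : ℕ → ℂ := fun j => ∑' k, φ k * T (basisVec j) k with hg
  have hg1 : ∀ j, ‖g j‖ ≤ 1 := fun j => (norm_pairing_le hφ1 _).trans (hTb j)
  set J : Set ℕ := {j | x j ≠ 0 ∧ (1 - η) * ‖x j‖ ≤ (α * (x j * g j)).re} with hJ
  have hmass : 1 - ε / 2 ≤ ∑' j, J.indicator (fun j => ‖x j‖) j := by
    have h1 := Complex.hasSum_re ((hasSum_pairing_map hφ1 T x).mul_left α)
    rw [hαT, Complex.ofReal_re] at h1
    have h2 : HasSum (J.indicator fun j => ‖x j‖) _ :=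
      ((hasSum_norm x).summable.indicator J).hasSum
    have h3 := hasSum_le (fun j => ?_) h1
      (((hasSum_norm x).mul_left (1 - η)).add (h2.mul_left η))
    · rw [hx] at h3
      nlinarith
    · change (α * (x j * g j)).re ≤ _
      by_cases hj : j ∈ J
      · rw [Set.indicator_of_mem hj]
        refine (Complex.re_le_norm _).trans ?_
        rw [norm_mul, norm_mul, hα]
        nlinarith [mul_le_mul_of_nonneg_left (hg1 j) (norm_nonneg (x j))]
      · rw [Set.indicator_of_notMem hj]
        by_cases hx0 : x j = 0
        · simp [hx0]
        · have : ¬ (1 - η) * ‖x j‖ ≤ (α * (x j * g j)).re := fun hh => hj ⟨hx0, hh⟩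
          linarith
  obtain ⟨y, m, hm, hy, hxy, hyJ, hyJ'⟩ := exists_normalized_restrict hx J hε1 hmass
  have hφxj := mul_eq_norm_of_pairing_eq_one hφ1 hx hφx
  have hφJ : ∀ j ∈ J, ‖φ j‖ = 1 := fun j hj => by
    have h1 := congrArg norm (hφxj j)
    rw [norm_mul, Complex.norm_real, norm_norm] at h1
    exact mul_right_cancel₀ (norm_ne_zero_iff.2 hj.1) (h1.trans (one_mul _).symm)
  have hconj : ∀ j ∈ J, φ j * (starRingEnd ℂ) (φ j) = 1 := fun j hj => by
    rw [Complex.mul_conj', hφJ j hj]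
    simp
  have hcol : ∀ j, ∃ s : L1, ‖s‖ ≤ 1 ∧ ‖T (basisVec j) - s‖ ≤ ε ∧
      (j ∈ J → α * ∑' k, normalizeLarge a φ k * s k = φ j) := fun j => by
    by_cases hj : j ∈ J
    · have hβ : ‖α * (starRingEnd ℂ) (φ j)‖ = 1 := by
        rw [norm_mul, RCLike.norm_conj, hα, hφJ j hj, one_mul]
      have h1 : 1 - η ≤ (α * (starRingEnd ℂ) (φ j) * g j).re := by
        have h2 : α * (x j * g j) = (‖x j‖ : ℂ) * (α * (starRingEnd ℂ) (φ j) * g j) := by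
          linear_combination (-α * x j * g j) * hconj j hj +
            (α * (starRingEnd ℂ) (φ j) * g j) * hφxj j
        have h3 := hj.2
        rw [h2, Complex.re_ofReal_mul, mul_comm] at h3
        exact le_of_mul_le_mul_left h3 (norm_pos_iff.2 hj.1)
      obtain ⟨s, hs, hs1, hs2⟩ := exists_column ha0 ha1 hφ1 (hφJ j hj) hβ (hTb j) h1
      refine ⟨s, hs, hs2.trans ?_, fun _ => ?_⟩
      · have h4 : η / a = ε / 8 := by
          rw [hη, ha]
          field_simp
          norm_num
        rw [h4]
        nlinarith
      · linear_combination φ j * hs1 -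
          (α * ∑' k, normalizeLarge a φ k * s k) * hconj j hj
    · exact ⟨T (basisVec j), hTb j, by simpa using hε.le, fun h => absurd h hj⟩
  choose s hs hTs hsJ using hcol
  obtain ⟨S, hS⟩ := exists_map_basisVec hs
  have hψ1 := norm_normalizeLarge_le ha1 hφ1
  obtain ⟨ψ, hψ⟩ := exists_lpInfty hψ1
  have hφy : HasSum (fun j => φ j * y j) 1 := by
    have h1 : HasSum (fun j => ((‖y j‖ : ℝ) : ℂ)) ((1 : ℝ) : ℂ) :=
      Complex.hasSum_ofReal.2 (hy ▸ hasSum_norm y)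
    rw [Complex.ofReal_one] at h1
    refine h1.congr_fun fun j => ?_
    by_cases hj : j ∈ J
    · rw [hyJ j hj, norm_mul, Complex.norm_real, Real.norm_eq_abs, abs_of_pos hm]
      push_cast
      linear_combination (m : ℂ) * hφxj j
    · simp [hyJ' j hj]
  have hψy : ∑' j, ψ j * y j = 1 := by
    rw [← hφy.tsum_eq]
    refine tsum_congr fun j => ?_
    by_cases hj : j ∈ J
    · rw [hψ, normalizeLarge_of_norm_eq_one ha0 (hφJ j hj)]
    · simp [hyJ' j hj]
  have hψle : ‖ψ‖ ≤ 1 := lp.norm_le_of_forall_le zero_le_one fun k => by rw [hψ]; exact hψ1 k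
  have hψn : ‖ψ‖ = 1 := by
    refine le_antisymm hψle ?_
    obtain ⟨j, hj⟩ : J.Nonempty := by
      by_contra hne
      rw [Set.not_nonempty_iff_eq_empty] at hne
      simp [hne] at hmass
      linarith
    rw [← hφJ j hj, ← normalizeLarge_of_norm_eq_one ha0 (hφJ j hj), ← hψ]
    exact lp.norm_apply_le_norm ENNReal.top_ne_zero ψ j
  have hSy : ‖∑' j : ℕ, ψ j * (S y) j‖ = 1 := by
    have h1 := (hasSum_pairing_map (norm_apply_le_of_norm_le hψle) S y).mul_left α
    have h2 : α * ∑' j : ℕ, ψ j * (S y) j = 1 := by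
      refine h1.unique (hφy.congr_fun fun j => ?_)
      by_cases hj : j ∈ J
      · simp only [hS, hψ]
        linear_combination y j * hsJ j hj
      · simp [hyJ' j hj]
    simpa [hα] using congrArg norm h2
  refine ⟨S, y, ψ, le_antisymm ?_ ?_, hy, hψn, hψy, ?_, hxy, ?_, hSy⟩
  · exact (l1NumRadius_le_norm S).trans (opNorm_le S zero_le_one fun j => by rw [hS]; exact hs j)
  · exact hSy ▸ le_l1NumRadius S hy hψn hψy
  · refine (l1NumRadius_le_norm _).trans (opNorm_le _ hε.le fun j => ?_)
    rw [sub_apply, hS]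
    exact hTs j
  · refine lp.norm_le_of_forall_le hε.le fun k => ?_
    rw [lp.coeFn_sub, Pi.sub_apply, hψ]
    exact (norm_sub_normalizeLarge_le ha0 ha1 hφ1 k).trans (by linarith)
end

section
/- The set NRA(ℓ₁) of numerical radius attaining bounded linear operators on ℓ₁ is dense in the space of all bounded linear operators on ℓ₁: for every bounded linear operator T : ℓ₁ → ℓ₁ and every ε > 0 there exists a bounded linear operator S : ℓ₁ → ℓ₁ with ‖T − S‖ ≤ ε and a pair (x, φ) ∈ Π(ℓ₁) with |φ(Sx)| = ν(S). -/
open scoped ENNReal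

/-- The pairing on `ℓ∞ × ℓ₁` is bounded by the product of the norms. -/
theorem norm_tsum_mul_le_linfty_l1 (φ : lp (fun _ : ℕ => ℂ) ∞) (y : lp (fun _ : ℕ => ℂ) 1) :
    ‖∑' j : ℕ, φ j * y j‖ ≤ ‖φ‖ * ‖y‖ := by
  have hy : HasSum (fun j => ‖y j‖) ‖y‖ := by
    simpa using lp.hasSum_norm (p := 1) (by simp) y
  refine tsum_of_norm_bounded (hy.mul_left ‖φ‖) fun j => ?_
  rw [norm_mul]
  gcongr
  exact lp.norm_apply_le_norm (by simp) φ j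

/-- An operator on `ℓ₁` is bounded by any common bound for its columns. -/
theorem l1_opNorm_le_of_single
    (S : lp (fun _ : ℕ => ℂ) 1 →L[ℂ] lp (fun _ : ℕ => ℂ) 1) {C : ℝ} (hC : 0 ≤ C)
    (h : ∀ n, ‖S (lp.single 1 n 1)‖ ≤ C) : ‖S‖ ≤ C := by
  refine S.opNorm_le_bound hC fun x => ?_
  have hx : HasSum (fun j => ‖x j‖) ‖x‖ := by
    simpa using lp.hasSum_norm (p := 1) (by simp) x
  have hS : HasSum (fun j => S (lp.single 1 j (x j))) (S x) :=
    S.hasSum (lp.hasSum_single (by simp) x)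
  rw [← hS.tsum_eq]
  refine tsum_of_norm_bounded (hx.mul_left C) fun j => ?_
  have : (lp.single 1 j (x j) : lp (fun _ : ℕ => ℂ) 1) = x j • lp.single 1 j 1 := by
    rw [← lp.single_smul]; simp
  rw [this, map_smul, norm_smul, mul_comm]
  gcongr
  exact h j

/-- A unimodular `u` with `u * z = ‖z‖`. -/
theorem exists_norm_one_mul_eq_norm (z : ℂ) : ∃ u : ℂ, ‖u‖ = 1 ∧ u * z = ‖z‖ := by
  by_cases hz : z = 0
  · exact ⟨1, by simp, by simp [hz]⟩
  · have hz' : (‖z‖ : ℂ) ≠ 0 := by simpa using hz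
    exact ⟨‖z‖ / z, by simp [hz], by field_simp⟩

/-- Every `t ∈ ℓ₁` is normed, up to a phase, by a norm-one functional taking the value `1` at a
given basis vector. -/
theorem exists_linfty_apply_eq_one (t : lp (fun _ : ℕ => ℂ) 1) (n : ℕ) :
    ∃ φ : lp (fun _ : ℕ => ℂ) ∞, ‖φ‖ = 1 ∧ φ n = 1 ∧ ‖∑' j : ℕ, φ j * t j‖ = ‖t‖ := by
  choose u hu hut using fun j => exists_norm_one_mul_eq_norm (t j)
  have hun : u n ≠ 0 := norm_ne_zero_iff.1 (by simp [hu])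
  have hnorm : ∀ j, ‖(u n)⁻¹ * u j‖ = 1 := fun j => by simp [hu]
  let φ : lp (fun _ : ℕ => ℂ) ∞ := ⟨fun j => (u n)⁻¹ * u j,
    memℓp_infty ⟨1, by rintro _ ⟨j, rfl⟩; exact (hnorm j).le⟩⟩
  have ht : HasSum (fun j => ‖t j‖) ‖t‖ := by
    simpa using lp.hasSum_norm (p := 1) (by simp) t
  refine ⟨φ, le_antisymm ?_ ?_, inv_mul_cancel₀ hun, ?_⟩
  · exact lp.norm_le_of_forall_le zero_le_one fun j => (hnorm j).le
  · exact (hnorm n).symm.le.trans (lp.norm_apply_le_norm (by simp) φ n)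
  · have : HasSum (fun j => φ j * t j) ((u n)⁻¹ * (‖t‖ : ℂ)) := by
      have h := (Complex.hasSum_ofReal.2 ht).mul_left (u n)⁻¹
      refine h.congr_fun fun j => ?_
      change (u n)⁻¹ * u j * t j = _
      rw [mul_assoc, hut]
    rw [this.tsum_eq]
    simp [hu]

/-- An operator on `ℓ₁` attaining its norm at a basis vector attains its numerical radius. -/
theorem l1NumRadius_attained_of_single
    (S : lp (fun _ : ℕ => ℂ) 1 →L[ℂ] lp (fun _ : ℕ => ℂ) 1) (n : ℕ)
    (h : ‖S (lp.single 1 n 1)‖ = ‖S‖) :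
    ∃ (x : lp (fun _ : ℕ => ℂ) 1) (φ : lp (fun _ : ℕ => ℂ) ∞),
      ‖x‖ = 1 ∧ ‖φ‖ = 1 ∧ (∑' j : ℕ, φ j * x j) = 1 ∧
      ‖∑' j : ℕ, φ j * (S x) j‖ = l1NumRadius S := by
  obtain ⟨φ, hφ, hφn, hφS⟩ := exists_linfty_apply_eq_one (S (lp.single 1 n 1)) n
  have hx : ‖(lp.single 1 n 1 : lp (fun _ : ℕ => ℂ) 1)‖ = 1 := by
    simp [lp.norm_single]
  have hpair : (∑' j : ℕ, φ j * (lp.single 1 n 1 : lp (fun _ : ℕ => ℂ) 1) j) = 1 := by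
    rw [tsum_eq_single n fun j hj => by simp [hj]]
    simp [hφn]
  refine ⟨lp.single 1 n 1, φ, hx, hφ, hpair, ?_⟩
  symm
  refine IsGreatest.csSup_eq ⟨⟨_, φ, hx, hφ, hpair, rfl⟩, ?_⟩
  rintro _ ⟨x, ψ, hx', hψ, -, rfl⟩
  calc ‖∑' j : ℕ, ψ j * (S x) j‖ ≤ ‖ψ‖ * ‖S x‖ := norm_tsum_mul_le_linfty_l1 ψ (S x)
    _ ≤ ‖S‖ := by simpa [hψ, hx'] using S.le_opNorm x
    _ = _ := by rw [hφS, h]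


/-- The numerical radius attaining operators on `ℓ₁(ℂ)` are dense in
`𝔏(ℓ₁)`. -/
theorem nra_dense_l1
    (T : lp (fun _ : ℕ => ℂ) 1 →L[ℂ] lp (fun _ : ℕ => ℂ) 1) (ε : ℝ) (hε : 0 < ε) :
    ∃ S : lp (fun _ : ℕ => ℂ) 1 →L[ℂ] lp (fun _ : ℕ => ℂ) 1,
      ‖T - S‖ ≤ ε ∧
      ∃ (x : lp (fun _ : ℕ => ℂ) 1) (φ : lp (fun _ : ℕ => ℂ) ∞),
        ‖x‖ = 1 ∧ ‖φ‖ = 1 ∧ (∑' j : ℕ, φ j * x j) = 1 ∧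
        ‖∑' j : ℕ, φ j * (S x) j‖ = l1NumRadius S := by
  by_cases hT : T = 0
  · refine ⟨0, by simpa [hT] using hε.le, l1NumRadius_attained_of_single 0 0 (by simp)⟩
  have hT0 : 0 < ‖T‖ := norm_pos_iff.2 hT
  obtain ⟨n, hn⟩ : ∃ n, max (‖T‖ - ε) 0 < ‖T (lp.single 1 n 1)‖ := by
    by_contra! hcon
    have := l1_opNorm_le_of_single T (le_max_right _ _) hcon
    exact absurd this (not_le.2 (max_lt (by linarith) hT0))
  obtain ⟨hnε, hn0⟩ := max_lt_iff.1 hn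
  have he : ∀ m, ‖(lp.single 1 m 1 : lp (fun _ : ℕ => ℂ) 1)‖ = 1 := fun m => by
    simp [lp.norm_single]
  have hle : ∀ m, ‖T (lp.single 1 m 1)‖ ≤ ‖T‖ := fun m => by
    simpa [he m] using T.le_opNorm (lp.single 1 m 1)
  set c : ℝ := ‖T‖ / ‖T (lp.single 1 n 1)‖ - 1 with hc
  have hc0 : 0 ≤ c := by
    rw [hc, sub_nonneg, one_le_div hn0]
    exact hle n
  have hcn : c * ‖T (lp.single 1 n 1)‖ = ‖T‖ - ‖T (lp.single 1 n 1)‖ := by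
    rw [hc]
    field_simp
  let R : lp (fun _ : ℕ => ℂ) 1 →L[ℂ] lp (fun _ : ℕ => ℂ) 1 :=
    (lp.evalCLM ℂ (fun _ : ℕ => ℂ) 1 n).smulRight ((c : ℂ) • T (lp.single 1 n 1))
  have hRn : R (lp.single 1 n 1) = (c : ℂ) • T (lp.single 1 n 1) := by
    simp [R, lp.evalCLM]
  have hRm : ∀ m, m ≠ n → R (lp.single 1 m 1) = 0 := fun m hm => by
    simp [R, lp.evalCLM, hm.symm]
  have hSn : ‖(T + R) (lp.single 1 n 1)‖ = ‖T‖ := by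
    have : (T + R) (lp.single 1 n 1) = ((1 + c : ℝ) : ℂ) • T (lp.single 1 n 1) := by
      rw [add_apply, hRn, Complex.ofReal_add, add_smul, Complex.ofReal_one,
        one_smul]
    rw [this, norm_smul, Complex.norm_real, Real.norm_of_nonneg (by linarith), add_mul, hcn]
    ring
  have hS : ‖T + R‖ = ‖T‖ := by
    refine le_antisymm (l1_opNorm_le_of_single _ hT0.le fun m => ?_) ?_
    · by_cases hm : m = n
      · rw [hm, hSn]
      · simpa [hRm m hm] using hle m
    · simpa only [hSn, he n, mul_one] using (T + R).le_opNorm (lp.single 1 n 1)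
  refine ⟨T + R, ?_, l1NumRadius_attained_of_single _ n (hSn.trans hS.symm)⟩
  rw [sub_add_cancel_left, norm_neg]
  refine l1_opNorm_le_of_single R hε.le fun m => ?_
  by_cases hm : m = n
  · rw [hm, hRn, norm_smul, Complex.norm_real, Real.norm_of_nonneg hc0, hcn]
    linarith
  · simpa [hRm m hm] using hε.le
end

section
/- The space c₀ has the Bishop-Phelps-Bollobás property for numerical radius: for every 0 < ε < 1 there exists δ > 0 such that whenever T : c₀ → c₀ is a bounded linear operator with ν(T) = 1 and (x, φ) ∈ Π(c₀) satisfies |φ(Tx)| ≥ 1 − δ, there exist a bounded linear operator S : c₀ → c₀ with ν(S) = 1 and a pair (y, ψ) ∈ Π(c₀) such that ν(T − S) ≤ ε, ‖x − y‖ ≤ ε, ‖φ − ψ‖ ≤ ε, and |ψ(Sy)| = 1. Moreover, since the numerical radius on c₀ equals the operator norm, ν may be replaced by the operator norm throughout. -/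
open scoped ENNReal ZeroAtInfty

/-- The numerical radius of a bounded linear operator on `c₀(ℂ)`:
`ν(T) = sup {|φ(Tx)| : (x, φ) ∈ Π(c₀)}`, where the dual of `c₀(ℂ)` is identified
with `ℓ₁(ℂ)` acting by `φ(x) = ∑ⱼ φⱼ xⱼ`. -/
noncomputable def c0NumRadius (T : C₀(ℕ, ℂ) →L[ℂ] C₀(ℕ, ℂ)) : ℝ :=
  sSup {r : ℝ | ∃ (x : C₀(ℕ, ℂ)) (φ : lp (fun _ : ℕ => ℂ) 1),
    ‖x‖ = 1 ∧ ‖φ‖ = 1 ∧ (∑' j : ℕ, φ j * x j) = 1 ∧ r = ‖∑' j : ℕ, φ j * (T x) j‖}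

namespace C0

theorem norm_le_iff (u : C₀(ℕ, ℂ)) {C : ℝ} (hC : 0 ≤ C) : ‖u‖ ≤ C ↔ ∀ j, ‖u j‖ ≤ C := by
  rw [← ZeroAtInftyContinuousMap.norm_toBCF_eq_norm]
  exact BoundedContinuousFunction.norm_le hC

theorem norm_apply_le (u : C₀(ℕ, ℂ)) (j : ℕ) : ‖u j‖ ≤ ‖u‖ :=
  (norm_le_iff u (norm_nonneg u)).1 le_rfl j

/-- Evaluation at a coordinate. -/
noncomputable def coord (j : ℕ) : C₀(ℕ, ℂ) →L[ℂ] ℂ :=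
  LinearMap.mkContinuous
    { toFun := fun u => u j
      map_add' := fun _ _ => rfl
      map_smul' := fun _ _ => rfl } 1 fun u => by
    simpa using norm_apply_le u j

@[simp]
theorem coord_apply (j : ℕ) (u : C₀(ℕ, ℂ)) : coord j u = u j := rfl

/-- The sequence equal to `v` on the finite set `K` and to `0` elsewhere. -/
noncomputable def truncate (K : Finset ℕ) (v : ℕ → ℂ) : C₀(ℕ, ℂ) where
  toFun j := if j ∈ K then v j else 0
  continuous_toFun := continuous_of_discreteTopology
  zero_at_infty' := by
    rw [Filter.cocompact_eq_cofinite]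
    refine tendsto_const_nhds.congr' ?_
    filter_upwards [K.finite_toSet.compl_mem_cofinite] with j hj
    have : j ∉ K := by simpa using hj
    simp [this]

theorem truncate_apply (K : Finset ℕ) (v : ℕ → ℂ) (j : ℕ) :
    truncate K v j = if j ∈ K then v j else 0 := rfl

theorem truncate_eq_sum (K : Finset ℕ) (v : ℕ → ℂ) :
    truncate K v = ∑ k ∈ K, v k • truncate {k} 1 := by
  ext j
  have := map_sum (coord j) (fun k => v k • truncate {k} 1) K
  rw [coord_apply] at this
  rw [this]
  simp [truncate_apply]

theorem finite_setOf_lt_norm (x : C₀(ℕ, ℂ)) {r : ℝ} (hr : 0 < r) : {k | r < ‖x k‖}.Finite := by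
  have h := x.zero_at_infty'
  rw [Filter.cocompact_eq_cofinite] at h
  have h2 := h.norm.eventually_lt_const (by simpa using hr)
  refine (Filter.eventually_cofinite.1 h2).subset fun k hk => ?_
  exact not_lt.2 (le_of_lt hk)

/-- A functional of norm at most one which almost attains its norm at `y` is close to one that
attains it, when the coordinates of `y` are unimodular on a finite set and bounded away from the
unit circle off this set. -/
theorem exists_functional_attaining (f : C₀(ℕ, ℂ) →L[ℂ] ℂ) (hf : ‖f‖ ≤ 1) (y : C₀(ℕ, ℂ))
    (K : Finset ℕ) {ε η : ℝ} (hε : 0 < ε) (hε1 : ε < 1) (hη : 0 ≤ η) (hηε : η ≤ ε ^ 3 / 12)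
    (hyK : ∀ k ∈ K, ‖y k‖ = 1) (hyo : ∀ k ∉ K, ‖y k‖ ≤ 1 - ε) (hfy : 1 - η ≤ (f y).re) :
    ∃ g : C₀(ℕ, ℂ) →L[ℂ] ℂ, ‖g‖ ≤ 1 ∧ g y = 1 ∧ ‖f - g‖ ≤ ε := by
  have hf1 : ∀ u, ‖f u‖ ≤ ‖u‖ := fun u => by
    simpa using f.le_of_opNorm_le hf u
  -- values on sequences vanishing on `K`
  have hoff1 : ∀ w : C₀(ℕ, ℂ), (∀ k ∈ K, w k = 0) → ‖w‖ ≤ 1 → ‖f w‖ ≤ η / ε := by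
    intro w hw hw1
    obtain ⟨c, hc, hcw⟩ := Complex.exists_norm_eq_mul_self (f w)
    have h1 : ‖y + ((ε : ℂ) * c) • w‖ ≤ 1 := by
      rw [norm_le_iff _ zero_le_one]
      intro k
      have : (y + ((ε : ℂ) * c) • w) k = y k + ((ε : ℂ) * c) * w k := rfl
      rw [this]
      by_cases hk : k ∈ K
      · simp [hw k hk, hyK k hk]
      · calc _ ≤ ‖y k‖ + ‖(ε : ℂ) * c * w k‖ := norm_add_le _ _
          _ ≤ (1 - ε) + ε * 1 := by
            rw [norm_mul, norm_mul, hc, Complex.norm_of_nonneg hε.le, mul_assoc, one_mul]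
            exact add_le_add (hyo k hk) (mul_le_mul_of_nonneg_left
              ((norm_apply_le w k).trans hw1) hε.le)
          _ = 1 := by ring
    have h2 := (Complex.re_le_norm _).trans ((hf1 _).trans h1)
    have h3 : f (y + ((ε : ℂ) * c) • w) = f y + ((ε * ‖f w‖ : ℝ) : ℂ) := by
      rw [map_add, map_smul, smul_eq_mul, mul_assoc, ← hcw]
      push_cast
      rfl
    rw [h3, Complex.add_re, Complex.ofReal_re] at h2
    rw [le_div_iff₀ hε]
    linarith
  have hoff : ∀ w : C₀(ℕ, ℂ), (∀ k ∈ K, w k = 0) → ‖f w‖ ≤ η / ε * ‖w‖ := by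
    intro w hw
    rcases eq_or_ne w 0 with rfl | hw0
    · simp
    have hpos : 0 < ‖w‖ := norm_pos_iff.2 hw0
    have := hoff1 (((‖w‖⁻¹ : ℝ) : ℂ) • w) (fun k hk => by
      change ((‖w‖⁻¹ : ℝ) : ℂ) * w k = 0
      rw [hw k hk, mul_zero]) (by
      rw [norm_smul, Complex.norm_of_nonneg (by positivity), inv_mul_cancel₀ hpos.ne'])
    rw [map_smul, norm_smul, Complex.norm_of_nonneg (by positivity)] at this
    rwa [inv_mul_le_iff₀ hpos, mul_comm] at this
  set μ : ℕ → ℂ := fun k => f (truncate {k} 1) with hμ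
  have hftr : ∀ v, f (truncate K v) = ∑ k ∈ K, v k * μ k := by
    intro v
    rw [truncate_eq_sum, map_sum]
    simp [hμ]
  have hdec : ∀ u : C₀(ℕ, ℂ), ∃ w : C₀(ℕ, ℂ), (∀ k ∈ K, w k = 0) ∧ ‖w‖ ≤ ‖u‖ ∧
      f u = ∑ k ∈ K, u k * μ k + f w := by
    intro u
    refine ⟨u - truncate K u, fun k hk => ?_, ?_, ?_⟩
    · change u k - truncate K u k = 0
      simp [truncate_apply, hk]
    · rw [norm_le_iff _ (norm_nonneg u)]
      intro k
      change ‖u k - truncate K u k‖ ≤ _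
      by_cases hk : k ∈ K
      · simp [truncate_apply, hk]
      · simpa [truncate_apply, hk] using norm_apply_le u k
    · rw [map_sub, hftr]
      ring
  set m : ℝ := ∑ k ∈ K, ‖μ k‖ with hm
  have hm1 : m ≤ 1 := by
    choose c hc hcμ using fun k => Complex.exists_norm_eq_mul_self (μ k)
    have h1 : ‖truncate K c‖ ≤ 1 := by
      rw [norm_le_iff _ zero_le_one]
      intro k
      rw [truncate_apply]
      split_ifs <;> simp [hc]
    have h2 := (hf1 _).trans h1
    rw [hftr, ← Finset.sum_congr rfl fun k _ => hcμ k, ← Complex.ofReal_sum,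
      Complex.norm_of_nonneg (Finset.sum_nonneg fun _ _ => norm_nonneg _)] at h2
    exact h2
  have hy1 : ‖y‖ ≤ 1 := by
    rw [norm_le_iff _ zero_le_one]
    intro k
    by_cases hk : k ∈ K
    · exact (hyK k hk).le
    · linarith [hyo k hk]
  have hηdiv : η / ε ≤ ε ^ 2 / 12 := by
    rw [div_le_iff₀ hε]
    linarith
  have hηdiv0 : 0 ≤ η / ε := by positivity
  set κ : ℝ := ε ^ 2 / 6 with hκ
  have hε2 : ε ^ 2 < 1 := by nlinarith
  have hre : 1 - κ ≤ ∑ k ∈ K, (y k * μ k).re := by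
    obtain ⟨w, hw, hwn, hfw⟩ := hdec y
    have h1 : (f w).re ≤ η / ε := (Complex.re_le_norm _).trans (hoff1 w hw (hwn.trans hy1))
    rw [hfw, Complex.add_re, Complex.re_sum] at hfy
    have : ε ^ 3 ≤ ε ^ 2 := by nlinarith [sq_nonneg ε]
    linarith
  have hnz : ∀ k ∈ K, ‖y k * μ k‖ = ‖μ k‖ := fun k hk => by rw [norm_mul, hyK k hk, one_mul]
  have hmκ : 1 - κ ≤ m := hre.trans (Finset.sum_le_sum fun k hk => by
    rw [← hnz k hk]
    exact Complex.re_le_norm _)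
  have hm0 : 0 < m := by linarith
  let a : ℕ → ℂ := fun k => ((‖μ k‖ / m : ℝ) : ℂ) * starRingEnd ℂ (y k)
  have ha : ∀ k ∈ K, ‖a k‖ = ‖μ k‖ / m := fun k hk => by
    simp only [a]
    rw [norm_mul, RCLike.norm_conj, hyK k hk, mul_one, Complex.norm_of_nonneg (by positivity)]
  have hyy : ∀ k ∈ K, starRingEnd ℂ (y k) * y k = 1 := fun k hk => by
    rw [Complex.conj_mul', hyK k hk]
    norm_num
  have hsm : ∑ k ∈ K, ‖μ k‖ / m = 1 := by
    rw [← Finset.sum_div, div_self hm0.ne']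
  let g : C₀(ℕ, ℂ) →L[ℂ] ℂ := ∑ k ∈ K, a k • coord k
  have hg : ∀ u, g u = ∑ k ∈ K, a k * u k := fun u => by
    simp [g]
  refine ⟨g, ?_, ?_, ?_⟩
  · refine g.opNorm_le_bound zero_le_one fun u => ?_
    rw [hg, ← hsm, Finset.sum_mul]
    refine norm_sum_le_of_le _ fun k hk => ?_
    rw [norm_mul, ha k hk]
    gcongr
    exact norm_apply_le u k
  · rw [hg, ← Complex.ofReal_one, ← hsm, Complex.ofReal_sum]
    refine Finset.sum_congr rfl fun k hk => ?_
    simp only [a]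
    rw [mul_assoc, hyy k hk, mul_one]
  · have hkey : ∀ k ∈ K, ‖μ k - a k‖ ≤
        ε / 2 * ‖μ k‖ + (‖μ k‖ - (y k * μ k).re) / ε + (‖μ k‖ / m - ‖μ k‖) := by
      intro k hk
      set z := y k * μ k with hz
      have hn : ‖z‖ = ‖μ k‖ := hnz k hk
      have h1 : ‖μ k - a k‖ = ‖z - (‖μ k‖ / m : ℝ)‖ := by
        have : y k * (μ k - a k) = z - (‖μ k‖ / m : ℝ) := by
          simp only [a, hz]
          linear_combination (-((‖μ k‖ / m : ℝ) : ℂ)) * hyy k hk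
        rw [← this, norm_mul, hyK k hk, one_mul]
      have h2 : ‖z - (‖μ k‖ / m : ℝ)‖ ≤ ‖z - (‖z‖ : ℝ)‖ + (‖μ k‖ / m - ‖μ k‖) := by
        have h3 : 0 ≤ ‖μ k‖ / m - ‖μ k‖ := by
          rw [sub_nonneg, le_div_iff₀ hm0]
          exact mul_le_of_le_one_right (norm_nonneg _) hm1
        have h4 : z - (‖μ k‖ / m : ℝ) =
            (z - (‖z‖ : ℝ)) - ((‖μ k‖ / m - ‖μ k‖ : ℝ) : ℂ) := by
          rw [hn]
          push_cast
          ring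
        rw [h4]
        refine (norm_sub_le _ _).trans ?_
        rw [Complex.norm_of_nonneg h3]
      have h5 : ‖z - (‖z‖ : ℝ)‖ ≤ ε / 2 * ‖z‖ + (‖z‖ - z.re) / ε := by
        have hd : 0 ≤ ‖z‖ - z.re := sub_nonneg.2 (Complex.re_le_norm z)
        refine abs_le_of_sq_le_sq' ?_ (by positivity) |>.2
        have h6 : ‖z - (‖z‖ : ℝ)‖ ^ 2 = 2 * ‖z‖ * (‖z‖ - z.re) := by
          have h7 := Complex.sq_norm z
          rw [Complex.normSq_apply] at h7
          rw [Complex.sq_norm, Complex.normSq_apply]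
          simp only [Complex.sub_re, Complex.sub_im, Complex.ofReal_re, Complex.ofReal_im]
          linarith
        have h8 : ε / 2 * ‖z‖ * ((‖z‖ - z.re) / ε) = ‖z‖ * (‖z‖ - z.re) / 2 := by
          field_simp
        nlinarith [sq_nonneg (ε / 2 * ‖z‖ - (‖z‖ - z.re) / ε)]
      rw [h1]
      rw [hn] at h5 h2
      linarith
    have hsum : ∑ k ∈ K, ‖μ k - a k‖ ≤ ε / 2 + κ / ε + κ := by
      refine (Finset.sum_le_sum hkey).trans ?_
      rw [Finset.sum_add_distrib, Finset.sum_add_distrib, ← Finset.mul_sum, ← Finset.sum_div,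
        Finset.sum_sub_distrib, Finset.sum_sub_distrib, hsm, ← hm]
      have : (m - ∑ k ∈ K, (y k * μ k).re) / ε ≤ κ / ε := by
        gcongr
        linarith
      have : ε / 2 * m ≤ ε / 2 * 1 := by gcongr
      linarith
    refine (f - g).opNorm_le_bound hε.le fun u => ?_
    obtain ⟨w, hw, hwn, hfw⟩ := hdec u
    have h1 : (f - g) u = ∑ k ∈ K, (μ k - a k) * u k + f w := by
      rw [sub_apply, hfw, hg, add_sub_right_comm, ← Finset.sum_sub_distrib]
      congr 1
      exact Finset.sum_congr rfl fun k _ => by ring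
    have h2 : ‖∑ k ∈ K, (μ k - a k) * u k‖ ≤ (∑ k ∈ K, ‖μ k - a k‖) * ‖u‖ := by
      rw [Finset.sum_mul]
      refine norm_sum_le_of_le _ fun k _ => ?_
      rw [norm_mul]
      gcongr
      exact norm_apply_le u k
    have h3 : κ / ε = ε / 6 := by
      rw [hκ]
      field_simp
    have h4 : κ ≤ ε / 6 := by
      rw [hκ]
      nlinarith
    calc ‖(f - g) u‖ ≤ (∑ k ∈ K, ‖μ k - a k‖) * ‖u‖ + η / ε * ‖w‖ := by
          rw [h1]
          exact (norm_add_le _ _).trans (add_le_add h2 (hoff w hw))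
      _ ≤ (∑ k ∈ K, ‖μ k - a k‖) * ‖u‖ + η / ε * ‖u‖ := by gcongr
      _ = (∑ k ∈ K, ‖μ k - a k‖ + η / ε) * ‖u‖ := by ring
      _ ≤ ε * ‖u‖ := by
        gcongr
        linarith


theorem summable_norm (φ : lp (fun _ : ℕ => ℂ) 1) : Summable fun j => ‖φ j‖ := by
  simpa using (lp.memℓp φ).summable (by simp)

theorem norm_eq_tsum (φ : lp (fun _ : ℕ => ℂ) 1) : ‖φ‖ = ∑' j, ‖φ j‖ := by
  simpa using lp.norm_eq_tsum_rpow (by simp) φ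

theorem norm_eq_sum (φ : lp (fun _ : ℕ => ℂ) 1) (K : Finset ℕ) (h : ∀ j ∉ K, φ j = 0) :
    ‖φ‖ = ∑ j ∈ K, ‖φ j‖ := by
  rw [norm_eq_tsum]
  exact tsum_eq_sum fun j hj => by rw [h j hj, norm_zero]

/-- The element of `ℓ₁` equal to `v` on the finite set `K` and to `0` elsewhere. -/
noncomputable def truncateDual (K : Finset ℕ) (v : ℕ → ℂ) : lp (fun _ : ℕ => ℂ) 1 :=
  ⟨fun j => if j ∈ K then v j else 0,
    (memℓp_zero (K.finite_toSet.subset fun j hj => by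
      by_contra hjK
      exact hj (if_neg hjK))).of_exponent_ge zero_le⟩

theorem truncateDual_apply (K : Finset ℕ) (v : ℕ → ℂ) (j : ℕ) :
    truncateDual K v j = if j ∈ K then v j else 0 := rfl

theorem norm_truncateDual (K : Finset ℕ) (v : ℕ → ℂ) :
    ‖truncateDual K v‖ = ∑ j ∈ K, ‖v j‖ := by
  rw [norm_eq_sum _ K fun j hj => by rw [truncateDual_apply, if_neg hj]]
  exact Finset.sum_congr rfl fun j hj => by rw [truncateDual_apply, if_pos hj]

theorem tsum_truncateDual_mul (K : Finset ℕ) (v : ℕ → ℂ) (u : ℕ → ℂ) :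
    ∑' j, truncateDual K v j * u j = ∑ j ∈ K, v j * u j := by
  rw [tsum_eq_sum (s := K) fun j hj => by rw [truncateDual_apply, if_neg hj, zero_mul]]
  exact Finset.sum_congr rfl fun j hj => by rw [truncateDual_apply, if_pos hj]

theorem summable_mul (φ : lp (fun _ : ℕ => ℂ) 1) (u : C₀(ℕ, ℂ)) :
    Summable fun j => φ j * u j :=
  ((summable_norm φ).mul_right ‖u‖).of_norm_bounded fun j => by
    rw [norm_mul]
    gcongr
    exact norm_apply_le u j

theorem norm_tsum_mul_le (φ : lp (fun _ : ℕ => ℂ) 1) (u : C₀(ℕ, ℂ)) :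
    ‖∑' j, φ j * u j‖ ≤ ‖φ‖ * ‖u‖ := by
  rw [norm_eq_tsum, ← tsum_mul_right]
  refine tsum_of_norm_bounded ((summable_norm φ).mul_right ‖u‖).hasSum fun j => ?_
  rw [norm_mul]
  gcongr
  exact norm_apply_le u j

theorem norm_tsum_le_opNorm (T : C₀(ℕ, ℂ) →L[ℂ] C₀(ℕ, ℂ)) {x : C₀(ℕ, ℂ)}
    {φ : lp (fun _ : ℕ => ℂ) 1} (hx : ‖x‖ = 1) (hφ : ‖φ‖ = 1) :
    ‖∑' j, φ j * (T x) j‖ ≤ ‖T‖ := by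
  have h1 := norm_tsum_mul_le φ (T x)
  have h2 := T.le_opNorm x
  rw [hφ, one_mul] at h1
  rw [hx, mul_one] at h2
  exact h1.trans h2

theorem numRadius_le_opNorm (T : C₀(ℕ, ℂ) →L[ℂ] C₀(ℕ, ℂ)) : c0NumRadius T ≤ ‖T‖ := by
  refine Real.sSup_le ?_ (norm_nonneg T)
  rintro r ⟨x, φ, hx, hφ, -, rfl⟩
  exact norm_tsum_le_opNorm T hx hφ

theorem le_numRadius (T : C₀(ℕ, ℂ) →L[ℂ] C₀(ℕ, ℂ)) {x : C₀(ℕ, ℂ)}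
    {φ : lp (fun _ : ℕ => ℂ) 1} (hx : ‖x‖ = 1) (hφ : ‖φ‖ = 1) (hφx : ∑' j, φ j * x j = 1) :
    ‖∑' j, φ j * (T x) j‖ ≤ c0NumRadius T := by
  refine le_csSup ⟨‖T‖, ?_⟩ ⟨x, φ, hx, hφ, hφx, rfl⟩
  rintro r ⟨x, φ, hx, hφ, -, rfl⟩
  exact norm_tsum_le_opNorm T hx hφ

theorem norm_apply_le_numRadius (T : C₀(ℕ, ℂ) →L[ℂ] C₀(ℕ, ℂ)) {x : C₀(ℕ, ℂ)} (hx : ‖x‖ = 1)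
    {j : ℕ} (hj : ‖x j‖ = 1) : ‖T x j‖ ≤ c0NumRadius T := by
  have h := le_numRadius T (φ := truncateDual {j} fun k => starRingEnd ℂ (x k)) hx
    (by simp [norm_truncateDual, hj]) (by
      rw [tsum_truncateDual_mul, Finset.sum_singleton, Complex.conj_mul', hj]
      norm_num)
  rw [tsum_truncateDual_mul, Finset.sum_singleton, norm_mul, RCLike.norm_conj, hj, one_mul] at h
  exact h

theorem opNorm_le_numRadius (T : C₀(ℕ, ℂ) →L[ℂ] C₀(ℕ, ℂ)) : ‖T‖ ≤ c0NumRadius T := by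
  have hν : 0 ≤ c0NumRadius T := by
    refine Real.sSup_nonneg ?_
    rintro r ⟨x, φ, -, -, -, rfl⟩
    exact norm_nonneg _
  refine T.opNorm_le_of_unit_norm hν fun u hu => ?_
  rw [norm_le_iff _ hν]
  intro j
  set e := truncate {j} 1
  obtain ⟨a, ha, haA⟩ := Complex.exists_norm_mul_eq_self (T (u - u j • e) j)
  obtain ⟨b, hb, hbB⟩ := Complex.exists_norm_eq_mul_self (T e j)
  set A := T (u - u j • e) j
  set B := T e j
  let w : C₀(ℕ, ℂ) := u - u j • e + (a * b) • e
  have hwj : ∀ k, w k = if k = j then a * b else u k := by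
    intro k
    change u k - u j * truncate {j} 1 k + a * b * truncate {j} 1 k = _
    rcases eq_or_ne k j with rfl | hk <;> simp [truncate_apply, *]
  have hw1 : ‖w j‖ = 1 := by simp [hwj, ha, hb]
  have hw : ‖w‖ = 1 := by
    refine le_antisymm ?_ (hw1 ▸ norm_apply_le w j)
    rw [norm_le_iff _ zero_le_one]
    intro k
    rw [hwj]
    split_ifs
    · simp [ha, hb]
    · exact hu ▸ norm_apply_le u k
  have h1 : T w j = a * ((‖A‖ + ‖B‖ : ℝ) : ℂ) := by
    have : T w j = A + a * b * B := by
      change T (u - u j • e + (a * b) • e) j = _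
      rw [map_add, map_smul]
      rfl
    rw [this, ← haA]
    push_cast
    rw [hbB, norm_mul, ha, Complex.norm_real, norm_norm]
    push_cast
    ring
  have h2 : T u j = A + u j * B := by
    have : T u j = T ((u - u j • e) + u j • e) j := by rw [sub_add_cancel]
    rw [this, map_add, map_smul]
    rfl
  calc ‖T u j‖ ≤ ‖A‖ + ‖u j‖ * ‖B‖ := by
        rw [h2, ← norm_mul]
        exact norm_add_le _ _
    _ ≤ ‖A‖ + 1 * ‖B‖ := by
        gcongr
        exact hu ▸ norm_apply_le u j
    _ = ‖T w j‖ := by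
        rw [h1, norm_mul, ha, Complex.norm_of_nonneg (by positivity)]
        ring
    _ ≤ c0NumRadius T := norm_apply_le_numRadius T hw hw1

theorem numRadius_eq_opNorm (T : C₀(ℕ, ℂ) →L[ℂ] C₀(ℕ, ℂ)) : c0NumRadius T = ‖T‖ :=
  (numRadius_le_opNorm T).antisymm (opNorm_le_numRadius T)

theorem mul_eq_norm_of_tsum_eq_one {x : C₀(ℕ, ℂ)} {φ : lp (fun _ : ℕ => ℂ) 1} (hx : ‖x‖ ≤ 1)
    (hφ : ‖φ‖ = 1) (hφx : ∑' j, φ j * x j = 1) (j : ℕ) : φ j * x j = (‖φ j‖ : ℂ) := by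
  have hle : ∀ k, ‖φ k * x k‖ ≤ ‖φ k‖ := fun k => by
    rw [norm_mul]
    exact mul_le_of_le_one_right (norm_nonneg _) ((norm_apply_le x k).trans hx)
  have h1 : HasSum (fun k => ‖φ k‖) 1 := by
    rw [← hφ, norm_eq_tsum]
    exact (summable_norm φ).hasSum
  have h2 : HasSum (fun k => (φ k * x k).re) 1 := by
    have := Complex.hasSum_re (summable_mul φ x).hasSum
    rwa [hφx, Complex.one_re] at this
  have h3 := h1.sub h2
  rw [sub_self, hasSum_zero_iff_of_nonneg fun k =>
    sub_nonneg.2 ((Complex.re_le_norm _).trans (hle k))] at h3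
  have h4 : ‖φ j‖ = (φ j * x j).re := sub_eq_zero.1 (congrFun h3 j)
  have h5 : (φ j * x j).re = ‖φ j * x j‖ :=
    le_antisymm (Complex.re_le_norm _) (h4 ▸ hle j)
  rw [h4]
  exact Complex.eq_re_of_ofReal_le (r := 0) (by simpa using Complex.re_eq_norm.1 h5)

theorem norm_smul_functional_le {c : ℂ} (hc : ‖c‖ = 1) (f : C₀(ℕ, ℂ) →L[ℂ] ℂ) :
    ‖c • f‖ ≤ ‖f‖ :=
  (c • f).opNorm_le_bound (norm_nonneg f) fun u => by
    change ‖c * f u‖ ≤ _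
    rw [norm_mul, hc, one_mul]
    exact f.le_opNorm u

/-- Replacing finitely many rows of an operator. -/
theorem exists_replace_rows (T : C₀(ℕ, ℂ) →L[ℂ] C₀(ℕ, ℂ)) (P : Finset ℕ)
    (g : ℕ → C₀(ℕ, ℂ) →L[ℂ] ℂ) : ∃ S : C₀(ℕ, ℂ) →L[ℂ] C₀(ℕ, ℂ),
      ∀ u j, S u j = if j ∈ P then g j u else T u j := by
  refine ⟨T + ∑ j ∈ P, (g j - (coord j).comp T).smulRight (truncate {j} 1), fun u j => ?_⟩
  have h : ∀ k, coord j ((g k - (coord k).comp T).smulRight (truncate {k} 1) u) =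
      if j = k then g k u - T u k else 0 := by
    intro k
    simp [truncate_apply]
  rw [← coord_apply, add_apply, sum_apply, map_add, map_sum]
  simp_rw [h]
  split_ifs with hj <;> simp [hj]

/-- Normalizing the coordinates of a norm-one sequence which are close to the unit circle. -/
theorem exists_unimodular_approx (x : C₀(ℕ, ℂ)) (hx : ‖x‖ ≤ 1) {ε : ℝ} (hε : 0 < ε)
    (hε1 : ε < 1) : ∃ (y : C₀(ℕ, ℂ)) (K : Finset ℕ), ‖x - y‖ ≤ ε ∧ ‖2 • x - y‖ ≤ 1 ∧
      (∀ k ∈ K, ‖y k‖ = 1) ∧ (∀ k ∉ K, ‖y k‖ ≤ 1 - ε) ∧ (∀ k ∉ K, ‖x k‖ ≤ 1 - ε) ∧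
      ∀ k, ‖x k‖ = 1 → y k = x k := by
  let K := (finite_setOf_lt_norm x (sub_pos.2 hε1)).toFinset
  have hK : ∀ k, k ∈ K ↔ 1 - ε < ‖x k‖ := fun k => by simp [K]
  have hx1 : ∀ k, ‖x k‖ ≤ 1 := fun k => (norm_apply_le x k).trans hx
  choose c hc hcx using fun k => Complex.exists_norm_mul_eq_self (x k)
  let y := x + truncate K fun k => c k - x k
  have hyK : ∀ k ∈ K, y k = c k := fun k hk => by
    change x k + truncate K _ k = _
    simp [truncate_apply, hk]
  have hyo : ∀ k ∉ K, y k = x k := fun k hk => by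
    change x k + truncate K _ k = _
    simp [truncate_apply, hk]
  refine ⟨y, K, ?_, ?_, fun k hk => by rw [hyK k hk, hc], fun k hk => ?_, fun k hk => ?_,
    fun k hk => ?_⟩
  · rw [norm_le_iff _ hε.le]
    intro k
    change ‖x k - y k‖ ≤ ε
    by_cases hk : k ∈ K
    · have : x k - y k = c k * ((‖x k‖ - 1 : ℝ) : ℂ) := by
        rw [hyK k hk]
        push_cast
        linear_combination -hcx k
      rw [this, norm_mul, hc, one_mul, Complex.norm_real, Real.norm_eq_abs, abs_le]
      constructor <;> linarith [hx1 k, (hK k).1 hk]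
    · rw [hyo k hk, sub_self, norm_zero]
      exact hε.le
  · rw [norm_le_iff _ zero_le_one]
    intro k
    have h2 : (2 • x - y) k = 2 * x k - y k := by
      rw [two_smul, two_mul]
      rfl
    rw [h2]
    by_cases hk : k ∈ K
    · have : 2 * x k - y k = c k * ((2 * ‖x k‖ - 1 : ℝ) : ℂ) := by
        rw [hyK k hk]
        push_cast
        linear_combination -2 * hcx k
      rw [this, norm_mul, hc, one_mul, Complex.norm_real, Real.norm_eq_abs, abs_le]
      constructor <;> linarith [hx1 k, norm_nonneg (x k)]
    · rw [hyo k hk, two_mul, add_sub_cancel_right]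
      exact hx1 k
  · rw [hyo k hk]
    exact not_lt.1 (mt (hK k).2 hk)
  · exact not_lt.1 (mt (hK k).2 hk)
  · by_cases h : k ∈ K
    · rw [hyK k h, ← hcx k, hk]
      simp
    · exact hyo k h

end C0

/-- `c₀(ℂ)` has the Bishop–Phelps–Bollobás property for numerical radius. -/
theorem bpb_property_numerical_radius_c0 :
    ∀ ε : ℝ, 0 < ε → ε < 1 → ∃ δ : ℝ, 0 < δ ∧
      ∀ (T : C₀(ℕ, ℂ) →L[ℂ] C₀(ℕ, ℂ)) (x : C₀(ℕ, ℂ)) (φ : lp (fun _ : ℕ => ℂ) 1),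
        c0NumRadius T = 1 →
        ‖x‖ = 1 → ‖φ‖ = 1 → (∑' j : ℕ, φ j * x j) = 1 →
        1 - δ ≤ ‖∑' j : ℕ, φ j * (T x) j‖ →
        ∃ (S : C₀(ℕ, ℂ) →L[ℂ] C₀(ℕ, ℂ)) (y : C₀(ℕ, ℂ)) (ψ : lp (fun _ : ℕ => ℂ) 1),
          c0NumRadius S = 1 ∧ ‖y‖ = 1 ∧ ‖ψ‖ = 1 ∧ (∑' j : ℕ, ψ j * y j) = 1 ∧
          c0NumRadius (T - S) ≤ ε ∧ ‖x - y‖ ≤ ε ∧ ‖φ - ψ‖ ≤ ε ∧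
          ‖∑' j : ℕ, ψ j * (S y) j‖ = 1 := by
  intro ε hε hε1
  set η : ℝ := ε ^ 3 / 24 with hη
  have hη0 : 0 < η := by positivity
  have hε3 : ε ^ 3 ≤ ε := by nlinarith [sq_nonneg ε]
  refine ⟨η ^ 2, by positivity, fun T x φ hT hx hφ hφx hTx => ?_⟩
  rw [C0.numRadius_eq_opNorm] at hT
  have hT1 : ∀ u, ‖T u‖ ≤ ‖u‖ := fun u => by simpa [hT] using T.le_opNorm u
  obtain ⟨y, K, hxy, h2xy, hyK, hyo, hxo, hyx⟩ := C0.exists_unimodular_approx x hx.le hε hε1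
  have hφxj := C0.mul_eq_norm_of_tsum_eq_one hx.le hφ hφx
  have hx1 : ∀ j, φ j ≠ 0 → ‖x j‖ = 1 := fun j hj => by
    have := congrArg norm (hφxj j)
    rw [norm_mul, Complex.norm_real, norm_norm] at this
    exact (mul_eq_left₀ (norm_ne_zero_iff.2 hj)).1 this
  have hφK : ∀ j ∉ K, φ j = 0 := fun j hj => by
    by_contra h
    linarith [hxo j hj, hx1 j h]
  have hφy : ∀ j, φ j * y j = (‖φ j‖ : ℂ) := fun j => by
    rw [← hφxj j]
    rcases eq_or_ne (φ j) 0 with h | h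
    · simp [h]
    · rw [hyx j (hx1 j h)]
  have hy1 : ‖y‖ ≤ 1 := by
    rw [C0.norm_le_iff _ zero_le_one]
    intro k
    by_cases hk : k ∈ K
    · exact (hyK k hk).le
    · linarith [hyo k hk]
  have hφsum := C0.norm_eq_sum φ K hφK
  rw [hφ] at hφsum
  rw [tsum_eq_sum (s := K) fun j hj => by rw [hφK j hj, zero_mul]] at hTx
  obtain ⟨c, hc, hcT⟩ := Complex.exists_norm_eq_mul_self (∑ j ∈ K, φ j * T x j)
  have hre : 1 - η ^ 2 ≤ ∑ j ∈ K, (c * (φ j * T x j)).re := by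
    rw [← Complex.re_sum, ← Finset.mul_sum, ← hcT, Complex.ofReal_re]
    exact hTx
  have hrele : ∀ j, (c * (φ j * T x j)).re ≤ ‖φ j‖ := fun j => by
    refine (Complex.re_le_norm _).trans ?_
    rw [norm_mul, hc, one_mul, norm_mul]
    exact mul_le_of_le_one_right (norm_nonneg _)
      ((C0.norm_apply_le _ j).trans ((hT1 x).trans hx.le))
  set P := K.filter fun j => φ j ≠ 0 ∧ (1 - η) * ‖φ j‖ ≤ (c * (φ j * T x j)).re with hP
  have hPK : P ⊆ K := Finset.filter_subset _ _
  set m := ∑ j ∈ P, ‖φ j‖ with hm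
  have hout : ∑ j ∈ K \ P, ‖φ j‖ = 1 - m := by
    rw [hφsum, ← Finset.sum_sdiff hPK]
    ring
  have hmη : 1 - η ≤ m := by
    have h1 : ∑ j ∈ K \ P, (c * (φ j * T x j)).re ≤ (1 - η) * (1 - m) := by
      rw [← hout, Finset.mul_sum]
      refine Finset.sum_le_sum fun j hj => ?_
      rw [Finset.mem_sdiff, hP, Finset.mem_filter] at hj
      by_cases h0 : φ j = 0
      · simp [h0]
      · by_contra! h
        exact hj.2 ⟨hj.1, h0, h.le⟩
    have h2 : ∑ j ∈ P, (c * (φ j * T x j)).re ≤ m := Finset.sum_le_sum fun j _ => hrele j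
    rw [← Finset.sum_sdiff hPK] at hre
    have h3 : η * (1 - m) ≤ η * η := by nlinarith
    linarith [le_of_mul_le_mul_left h3 hη0]
  have hm0 : 0 < m := by linarith
  have hm1 : m ≤ 1 := by
    have : 0 ≤ ∑ j ∈ K \ P, ‖φ j‖ := Finset.sum_nonneg fun _ _ => norm_nonneg _
    linarith
  have hrow : ∀ j ∈ P, ∃ g : C₀(ℕ, ℂ) →L[ℂ] ℂ,
      ‖g‖ ≤ 1 ∧ c * (φ j * g y) = (‖φ j‖ : ℂ) ∧ ‖(C0.coord j).comp T - g‖ ≤ ε := by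
    intro j hj
    rw [hP, Finset.mem_filter] at hj
    obtain ⟨-, hj0, hj⟩ := hj
    have hnj : 0 < ‖φ j‖ := norm_pos_iff.2 hj0
    obtain ⟨d, hd, hdφ⟩ := Complex.exists_norm_mul_eq_self (φ j)
    have hcd : ‖c * d‖ = 1 := by rw [norm_mul, hc, hd, one_mul]
    have hcd0 : c * d ≠ 0 := norm_ne_zero_iff.1 (by rw [hcd]; exact one_ne_zero)
    set f : C₀(ℕ, ℂ) →L[ℂ] ℂ := (c * d) • (C0.coord j).comp T with hf
    have hf1 : ∀ u, ‖f u‖ ≤ ‖u‖ := fun u => by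
      change ‖(c * d) * T u j‖ ≤ ‖u‖
      rw [norm_mul, hcd, one_mul]
      exact (C0.norm_apply_le _ j).trans (hT1 u)
    have hfx : 1 - η ≤ (f x).re := by
      have h1 : c * (φ j * T x j) = (‖φ j‖ : ℂ) * f x := by
        change _ = (‖φ j‖ : ℂ) * (c * d * T x j)
        linear_combination -(c * T x j) * hdφ
      rw [h1, Complex.re_ofReal_mul, mul_comm] at hj
      exact le_of_mul_le_mul_left hj hnj
    have hfy : 1 - 2 * η ≤ (f y).re := by
      have h1 := (Complex.re_le_norm _).trans ((hf1 (2 • x - y)).trans h2xy)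
      rw [map_sub, map_nsmul, Complex.sub_re, two_smul, Complex.add_re] at h1
      linarith
    obtain ⟨g, hg, hgy, hfg⟩ := C0.exists_functional_attaining f
      (f.opNorm_le_bound zero_le_one fun u => by simpa using hf1 u) y K hε hε1
      (by positivity : 0 ≤ 2 * η) (by rw [hη]; linarith) hyK hyo hfy
    have hinv : ‖(c * d)⁻¹‖ = 1 := by rw [norm_inv, hcd, inv_one]
    refine ⟨(c * d)⁻¹ • g, ?_, ?_, ?_⟩
    · exact (C0.norm_smul_functional_le hinv g).trans hg
    · change c * (φ j * ((c * d)⁻¹ * g y)) = _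
      rw [hgy, mul_one]
      have : c * φ j = (c * d) * (‖φ j‖ : ℂ) := by
        linear_combination -c * hdφ
      rw [← mul_assoc, this, mul_comm, inv_mul_cancel_left₀ hcd0]
    · have : (C0.coord j).comp T - (c * d)⁻¹ • g = (c * d)⁻¹ • (f - g) := by
        ext u
        change T u j - (c * d)⁻¹ * g u = (c * d)⁻¹ * (c * d * T u j - g u)
        rw [mul_sub, inv_mul_cancel_left₀ hcd0]
      rw [this]
      exact (C0.norm_smul_functional_le hinv _).trans hfg
  choose! g hg hgy hgT using hrow
  obtain ⟨S, hS⟩ := C0.exists_replace_rows T P g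
  have hψ : ‖C0.truncateDual P fun j => φ j / m‖ = 1 := by
    rw [C0.norm_truncateDual]
    simp_rw [norm_div, Complex.norm_of_nonneg hm0.le]
    rw [← Finset.sum_div, div_self hm0.ne']
  have hsum : ∑ j ∈ P, (‖φ j‖ : ℂ) / m = 1 := by
    rw [← Finset.sum_div, ← Complex.ofReal_sum, ← hm, div_self (by exact_mod_cast hm0.ne')]
  have hψy : ∑' j, C0.truncateDual P (fun j => φ j / m) j * y j = 1 := by
    rw [C0.tsum_truncateDual_mul, ← hsum]
    refine Finset.sum_congr rfl fun j _ => ?_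
    rw [← hφy j]
    ring
  have hynorm : ‖y‖ = 1 := by
    refine le_antisymm hy1 ?_
    have := C0.norm_tsum_mul_le (C0.truncateDual P fun j => φ j / m) y
    rwa [hψy, hψ, one_mul, norm_one] at this
  have hψS : ‖∑' j, C0.truncateDual P (fun j => φ j / m) j * S y j‖ = 1 := by
    have h : c * ∑ j ∈ P, φ j / m * S y j = 1 := by
      rw [Finset.mul_sum, ← hsum]
      refine Finset.sum_congr rfl fun j hj => ?_
      rw [hS, if_pos hj, ← hgy j hj]
      ring
    rw [C0.tsum_truncateDual_mul]
    simpa [hc] using congrArg norm h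
  have hS1 : ‖S‖ ≤ 1 := by
    refine S.opNorm_le_bound zero_le_one fun u => ?_
    rw [one_mul, C0.norm_le_iff _ (norm_nonneg u)]
    intro j
    rw [hS]
    split_ifs with hj
    · simpa using (g j).le_of_opNorm_le (hg j hj) u
    · exact (C0.norm_apply_le _ j).trans (hT1 u)
  refine ⟨S, y, C0.truncateDual P fun j => φ j / m, ?_, hynorm, hψ, hψy, ?_, hxy, ?_, hψS⟩
  · exact ((C0.numRadius_le_opNorm S).trans hS1).antisymm
      (hψS ▸ C0.le_numRadius S hynorm hψ hψy)
  · refine (C0.numRadius_le_opNorm _).trans ((T - S).opNorm_le_bound hε.le fun u => ?_)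
    rw [C0.norm_le_iff _ (by positivity)]
    intro j
    change ‖T u j - S u j‖ ≤ _
    rw [hS]
    split_ifs with hj
    · exact ((C0.coord j).comp T - g j).le_of_opNorm_le (hgT j hj) u
    · rw [sub_self, norm_zero]
      positivity
  · have hval : ∀ j, (φ - C0.truncateDual P fun j => φ j / m) j =
        φ j - if j ∈ P then φ j / m else 0 := fun _ => rfl
    rw [C0.norm_eq_sum _ K fun j hj => by
      rw [hval, hφK j hj, if_neg fun h => hj (hPK h), sub_zero], ← Finset.sum_sdiff hPK]
    have h1 : ∑ j ∈ K \ P, ‖(φ - C0.truncateDual P fun j => φ j / m) j‖ = 1 - m := by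
      rw [← hout]
      refine Finset.sum_congr rfl fun j hj => ?_
      rw [hval, if_neg (Finset.mem_sdiff.1 hj).2, sub_zero]
    have h2 : ∑ j ∈ P, ‖(φ - C0.truncateDual P fun j => φ j / m) j‖ = 1 - m := by
      have : 1 - m = ∑ j ∈ P, ‖φ j‖ * (1 / m - 1) := by
        rw [← Finset.sum_mul, ← hm]
        field_simp
      rw [this]
      refine Finset.sum_congr rfl fun j hj => ?_
      have h3 : φ j - φ j / m = -(φ j * ((1 / m - 1 : ℝ) : ℂ)) := by
        push_cast
        ring
      rw [hval, if_pos hj, h3, norm_neg, norm_mul, Complex.norm_of_nonneg]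
      rw [sub_nonneg, le_div_iff₀ hm0]
      linarith
    rw [h1, h2]
    linarith
end

section
/- The set NRA(c₀) of numerical radius attaining bounded linear operators on c₀ is dense in the space of all bounded linear operators on c₀: for every bounded linear operator T : c₀ → c₀ and every ε > 0 there exists a bounded linear operator S : c₀ → c₀ with ‖T − S‖ ≤ ε and a pair (x, φ) ∈ Π(c₀) with |φ(Sx)| = ν(S). -/
open scoped ENNReal ZeroAtInfty

/-- The `j`-th vector of the canonical basis of `c₀(ℂ)`. -/
noncomputable def c0Basis (j : ℕ) : C₀(ℕ, ℂ) where
  toFun := Pi.single j 1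
  continuous_toFun := continuous_of_discreteTopology
  zero_at_infty' := by
    rw [Filter.cocompact_eq_cofinite]
    refine tendsto_const_nhds.congr' ?_
    filter_upwards [(Set.finite_singleton j).compl_mem_cofinite] with k hk
    exact (Pi.single_eq_of_ne (M := fun _ : ℕ => ℂ) (by simpa using hk) 1).symm

lemma c0Basis_apply (j k : ℕ) : c0Basis j k = if k = j then 1 else 0 := by
  change (Pi.single j (1 : ℂ) : ℕ → ℂ) k = _
  rw [Pi.single_apply]

lemma c0_norm_apply_le (x : C₀(ℕ, ℂ)) (k : ℕ) : ‖x k‖ ≤ ‖x‖ :=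
  x.toBCF.norm_coe_le_norm k

lemma c0_norm_le {x : C₀(ℕ, ℂ)} {M : ℝ} (hM : 0 ≤ M) (h : ∀ k, ‖x k‖ ≤ M) : ‖x‖ ≤ M := by
  rw [← ZeroAtInftyContinuousMap.norm_toBCF_eq_norm]
  exact (BoundedContinuousFunction.norm_le hM).2 h

/-- The `j`-th coordinate functional on `c₀(ℂ)`. -/
noncomputable def c0Coord (j : ℕ) : C₀(ℕ, ℂ) →L[ℂ] ℂ :=
  LinearMap.mkContinuous
    { toFun := fun x => x j
      map_add' := fun _ _ => rfl
      map_smul' := fun _ _ => rfl }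
    1 fun x => by simpa using c0_norm_apply_le x j

@[simp] lemma c0Coord_apply (j : ℕ) (x : C₀(ℕ, ℂ)) : c0Coord j x = x j := rfl

lemma c0_sum_smul_basis_apply (F : Finset ℕ) (d : ℕ → ℂ) (k : ℕ) :
    (∑ j ∈ F, d j • c0Basis j) k = if k ∈ F then d k else 0 := by
  rw [← c0Coord_apply, map_sum]
  simp [c0Basis_apply]

/-- Every element of `c₀(ℂ)` is approximated by its restrictions to large finite sets. -/
lemma c0_exists_finset_norm_sub_le (x : C₀(ℕ, ℂ)) {η : ℝ} (hη : 0 < η) :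
    ∃ F : Finset ℕ, ∀ G : Finset ℕ, F ⊆ G → ‖x - ∑ j ∈ G, x j • c0Basis j‖ ≤ η := by
  have h := x.zero_at_infty'
  rw [Filter.cocompact_eq_cofinite] at h
  have h' : {k | ¬ ‖x k‖ < η}.Finite := by
    have := h.eventually (Metric.ball_mem_nhds 0 hη)
    simpa [Filter.eventually_cofinite] using this
  refine ⟨h'.toFinset, fun G hG => c0_norm_le hη.le fun k => ?_⟩
  rw [ZeroAtInftyContinuousMap.sub_apply, c0_sum_smul_basis_apply]
  split_ifs with hk
  · simpa using hη.le
  · have : k ∉ h'.toFinset := fun hk' => hk (hG hk')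
    simp only [Set.Finite.mem_toFinset, Set.mem_ofPred_eq, not_not] at this
    simpa using this.le

/-- The pairing of `ℓ₁` with `c₀` is bounded by the product of the norms. -/
lemma norm_tsum_mul_c0_le (φ : lp (fun _ : ℕ => ℂ) 1) (z : C₀(ℕ, ℂ)) :
    ‖∑' j : ℕ, φ j * z j‖ ≤ ‖φ‖ * ‖z‖ := by
  have hs : HasSum (fun j => ‖φ j‖) ‖φ‖ := by
    simpa using lp.hasSum_norm (p := 1) (by simp) φ
  refine tsum_of_norm_bounded (hs.mul_right ‖z‖) fun j => ?_
  rw [norm_mul]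
  exact mul_le_mul_of_nonneg_left (c0_norm_apply_le z j) (norm_nonneg _)

/-- A bounded operator on `c₀(ℂ)` attains its numerical radius if the modulus of some coordinate
of `S w` is `‖S‖`, where `w` is a norm-one vector that is unimodular at that coordinate. -/
lemma c0NumRadius_attained (S : C₀(ℕ, ℂ) →L[ℂ] C₀(ℕ, ℂ)) (w : C₀(ℕ, ℂ)) (i : ℕ)
    (hw : ‖w‖ = 1) (hwi : ‖w i‖ = 1) (hS : ‖S‖ ≤ ‖S w i‖) :
    ∃ (x : C₀(ℕ, ℂ)) (φ : lp (fun _ : ℕ => ℂ) 1),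
      ‖x‖ = 1 ∧ ‖φ‖ = 1 ∧ (∑' j : ℕ, φ j * x j) = 1 ∧
      ‖∑' j : ℕ, φ j * (S x) j‖ = c0NumRadius S := by
  have hsum (z : C₀(ℕ, ℂ)) :
      ∑' j : ℕ, (lp.single 1 i (w i)⁻¹ : lp (fun _ : ℕ => ℂ) 1) j * z j = (w i)⁻¹ * z i := by
    rw [tsum_eq_single i]
    · simp
    · intro j hj
      simp [Pi.single_eq_of_ne hj]
  have hφ : ‖(lp.single 1 i (w i)⁻¹ : lp (fun _ : ℕ => ℂ) 1)‖ = 1 := by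
    rw [lp.norm_single (by simp)]
    simp [hwi]
  have hx1 : (w i)⁻¹ * w i = 1 := inv_mul_cancel₀ (norm_ne_zero_iff.1 (by simp [hwi]))
  refine ⟨w, lp.single 1 i (w i)⁻¹, hw, hφ, (hsum w).trans hx1, ?_⟩
  symm
  refine IsGreatest.csSup_eq ⟨⟨w, _, hw, hφ, (hsum w).trans hx1, rfl⟩, ?_⟩
  rintro r ⟨x, φ, hx, hφ', -, rfl⟩
  calc _ ≤ ‖φ‖ * ‖S x‖ := norm_tsum_mul_c0_le φ (S x)
    _ ≤ ‖S‖ := by simpa [hφ', hx] using S.le_opNorm x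
    _ ≤ _ := by rw [hsum, norm_mul, norm_inv, hwi]; simpa using hS

/-- Some row of the matrix of an operator on `c₀(ℂ)`, restricted to a finite set, has `ℓ₁`-norm
close to the norm of the operator. -/
lemma c0_exists_row_sum_gt (T : C₀(ℕ, ℂ) →L[ℂ] C₀(ℕ, ℂ)) {δ : ℝ} (hδ : 0 < δ) :
    ∃ (i : ℕ) (F : Finset ℕ), i ∈ F ∧ ‖T‖ < ∑ j ∈ F, ‖T (c0Basis j) i‖ + δ := by
  by_contra! H
  have hT : ‖T‖ ≤ max 0 (‖T‖ - δ) := by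
    refine T.opNorm_le_of_unit_norm (le_max_left _ _) fun x hx => ?_
    refine le_of_forall_pos_le_add fun η hη => c0_norm_le (by positivity) fun i => ?_
    have hη' : 0 < η / (‖T‖ + 1) := by positivity
    obtain ⟨F, hF⟩ := c0_exists_finset_norm_sub_le x hη'
    have h1 := hF (insert i F) (Finset.subset_insert i F)
    set y := ∑ j ∈ insert i F, x j • c0Basis j with hy
    have h2 : ‖T y i‖ ≤ ∑ j ∈ insert i F, ‖T (c0Basis j) i‖ := by
      rw [← c0Coord_apply, hy, map_sum, map_sum]
      refine norm_sum_le_of_le _ fun j _ => ?_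
      rw [map_smul, map_smul, norm_smul, c0Coord_apply]
      exact mul_le_of_le_one_left (norm_nonneg _) (hx ▸ c0_norm_apply_le x j)
    have h3 : ‖T (x - y) i‖ ≤ η := by
      calc _ ≤ ‖T (x - y)‖ := c0_norm_apply_le _ i
        _ ≤ ‖T‖ * (η / (‖T‖ + 1)) := T.le_opNorm_of_le h1
        _ ≤ (‖T‖ + 1) * (η / (‖T‖ + 1)) := by gcongr; linarith
        _ = η := mul_div_cancel₀ _ (by positivity)
    have h4 : T x i = T y i + T (x - y) i := by
      rw [← ZeroAtInftyContinuousMap.add_apply, ← map_add, add_sub_cancel]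
    have h5 := H i (insert i F) (Finset.mem_insert_self i F)
    have h6 := le_max_right 0 (‖T‖ - δ)
    rw [h4]
    linarith [norm_add_le (T y i) (T (x - y) i)]
  rcases le_max_iff.1 hT with h | h
  · have h5 := H 0 {0} (by simp)
    have : 0 ≤ ∑ j ∈ {0}, ‖T (c0Basis j) 0‖ := by positivity
    linarith
  · linarith

/-- A functional on `c₀(ℂ)` whose restriction to a finite set of coordinates almost has full norm
is small on the remaining coordinates. -/
lemma c0_norm_apply_sub_le (f : C₀(ℕ, ℂ) →L[ℂ] ℂ) (F : Finset ℕ) (y : C₀(ℕ, ℂ)) :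
    ‖f (y - ∑ j ∈ F, y j • c0Basis j)‖ ≤ (‖f‖ - ∑ j ∈ F, ‖f (c0Basis j)‖) * ‖y‖ := by
  choose d hd hda using fun j => RCLike.exists_norm_eq_mul_self (f (c0Basis j))
  set v := y - ∑ j ∈ F, y j • c0Basis j with hv
  obtain ⟨c, hc, hcv⟩ := RCLike.exists_norm_eq_mul_self (f v)
  set u := ∑ j ∈ F, ((‖y‖ : ℂ) * d j) • c0Basis j + c • v with hu
  have hun : ‖u‖ ≤ ‖y‖ := by
    refine c0_norm_le (norm_nonneg _) fun k => ?_
    rw [hu, ZeroAtInftyContinuousMap.add_apply, ZeroAtInftyContinuousMap.smul_apply, hv,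
      ZeroAtInftyContinuousMap.sub_apply, c0_sum_smul_basis_apply, c0_sum_smul_basis_apply]
    split_ifs with hk
    · simp [hd]
    · simpa [hc] using c0_norm_apply_le y k
  have hfu : f u = ((‖y‖ * ∑ j ∈ F, ‖f (c0Basis j)‖ + ‖f v‖ : ℝ) : ℂ) := by
    rw [hu, map_add, map_sum, map_smul, smul_eq_mul, ← hcv]
    push_cast
    rw [Finset.mul_sum]
    congr 1
    refine Finset.sum_congr rfl fun j _ => ?_
    rw [map_smul, smul_eq_mul, mul_assoc, ← hda]
    rfl
  have h := f.le_opNorm_of_le hun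
  rw [hfu, Complex.norm_real] at h
  linarith [Real.le_norm_self (‖y‖ * ∑ j ∈ F, ‖f (c0Basis j)‖ + ‖f v‖)]

/-- The numerical radius attaining operators on `c₀(ℂ)` are dense in
`𝔏(c₀)`. -/
theorem nra_dense_c0
    (T : C₀(ℕ, ℂ) →L[ℂ] C₀(ℕ, ℂ)) (ε : ℝ) (hε : 0 < ε) :
    ∃ S : C₀(ℕ, ℂ) →L[ℂ] C₀(ℕ, ℂ),
      ‖T - S‖ ≤ ε ∧
      ∃ (x : C₀(ℕ, ℂ)) (φ : lp (fun _ : ℕ => ℂ) 1),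
        ‖x‖ = 1 ∧ ‖φ‖ = 1 ∧ (∑' j : ℕ, φ j * x j) = 1 ∧
        ‖∑' j : ℕ, φ j * (S x) j‖ = c0NumRadius S := by
  obtain ⟨i, F, hi, hF⟩ := c0_exists_row_sum_gt T (half_pos hε)
  set δ := ε / 2 with hδ
  have hδ0 : 0 < δ := half_pos hε
  set f : C₀(ℕ, ℂ) →L[ℂ] ℂ := (c0Coord i).comp T with hf
  have hfT (y : C₀(ℕ, ℂ)) : f y = T y i := rfl
  set s := ∑ j ∈ F, ‖T (c0Basis j) i‖ with hs
  have hs0 : 0 ≤ s := by positivity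
  have hfn : ‖f‖ ≤ ‖T‖ := f.opNorm_le_bound (norm_nonneg T) fun y =>
    (c0_norm_apply_le _ i).trans (T.le_opNorm y)
  choose d hd hda using fun j => RCLike.exists_norm_eq_mul_self (T (c0Basis j) i)
  set h : C₀(ℕ, ℂ) →L[ℂ] ℂ := ∑ j ∈ F, T (c0Basis j) i • c0Coord j with hh
  have hhy (y : C₀(ℕ, ℂ)) : h y = ∑ j ∈ F, T (c0Basis j) i * y j := by
    simp [hh]
  have hhf (y : C₀(ℕ, ℂ)) : ‖f y - h y‖ ≤ δ * ‖y‖ := by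
    have h1 := c0_norm_apply_sub_le f F y
    have h2 : f (y - ∑ j ∈ F, y j • c0Basis j) = f y - h y := by
      rw [map_sub, map_sum, hhy]
      congr 1
      refine Finset.sum_congr rfl fun j _ => ?_
      rw [map_smul, smul_eq_mul, mul_comm, hfT]
    rw [h2] at h1
    refine h1.trans (mul_le_mul_of_nonneg_right ?_ (norm_nonneg _))
    simp only [hfT]
    linarith
  set p : C₀(ℕ, ℂ) →L[ℂ] ℂ := f - h - ((δ : ℂ) * (d i)⁻¹) • c0Coord i with hp
  have hpy (y : C₀(ℕ, ℂ)) : p y = f y - h y - (δ : ℂ) * (d i)⁻¹ * y i := by simp [hp]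
  have hdn (y : C₀(ℕ, ℂ)) : ‖(δ : ℂ) * (d i)⁻¹ * y i‖ ≤ δ * ‖y‖ := by
    rw [norm_mul, norm_mul, norm_inv, hd, Complex.norm_real, Real.norm_of_nonneg hδ0.le]
    simpa using mul_le_mul_of_nonneg_left (c0_norm_apply_le y i) hδ0.le
  set S : C₀(ℕ, ℂ) →L[ℂ] C₀(ℕ, ℂ) := T - p.smulRight (c0Basis i) with hS
  have hSy (y : C₀(ℕ, ℂ)) (k : ℕ) : S y k = T y k - p y * (if k = i then 1 else 0) := by
    rw [← c0Basis_apply]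
    rfl
  have hSi (y : C₀(ℕ, ℂ)) : S y i = h y + (δ : ℂ) * (d i)⁻¹ * y i := by
    rw [hSy, if_pos rfl, hpy, hfT]
    ring
  refine ⟨S, ?_, c0NumRadius_attained S (∑ j ∈ F, d j • c0Basis j) i ?_ ?_ ?_⟩
  · refine ContinuousLinearMap.opNorm_le_bound _ hε.le fun y => ?_
    refine c0_norm_le (by positivity) fun k => ?_
    change ‖T y k - S y k‖ ≤ _
    rw [hSy, sub_sub_cancel]
    have h1 : ‖p y‖ ≤ ε * ‖y‖ := by
      rw [hpy]
      have h2 := norm_sub_le (f y - h y) ((δ : ℂ) * (d i)⁻¹ * y i)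
      have h3 : ε = δ + δ := by rw [hδ]; ring
      rw [h3, add_mul]
      linarith [hhf y, hdn y]
    split_ifs
    · simpa using h1
    · simp only [mul_zero, norm_zero]
      positivity
  · refine le_antisymm (c0_norm_le zero_le_one fun k => ?_) ?_
    · rw [c0_sum_smul_basis_apply]
      split_ifs <;> simp [hd]
    · refine le_trans ?_ (c0_norm_apply_le _ i)
      rw [c0_sum_smul_basis_apply, if_pos hi, hd]
  · rw [c0_sum_smul_basis_apply, if_pos hi, hd]
  · have hw : S (∑ j ∈ F, d j • c0Basis j) i = ((s + δ : ℝ) : ℂ) := by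
      have hdi : d i ≠ 0 := norm_ne_zero_iff.1 (by simp [hd])
      rw [hSi, hhy, c0_sum_smul_basis_apply, if_pos hi, inv_mul_cancel_right₀ hdi, hs]
      push_cast
      congr 1
      refine Finset.sum_congr rfl fun j hj => ?_
      rw [c0_sum_smul_basis_apply, if_pos hj, mul_comm, ← hda]
      rfl
    rw [hw, Complex.norm_real, Real.norm_of_nonneg (by positivity)]
    refine S.opNorm_le_bound (by positivity) fun y => ?_
    refine c0_norm_le (by positivity) fun k => ?_
    by_cases hk : k = i
    · rw [hk, hSi, add_mul]
      refine (norm_add_le _ _).trans (add_le_add ?_ (hdn y))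
      rw [hhy, hs, Finset.sum_mul]
      refine norm_sum_le_of_le _ fun j _ => ?_
      rw [norm_mul]
      exact mul_le_mul_of_nonneg_left (c0_norm_apply_le y j) (norm_nonneg _)
    · rw [hSy, if_neg hk, mul_zero, sub_zero]
      refine (c0_norm_apply_le _ k).trans ((T.le_opNorm y).trans ?_)
      exact mul_le_mul_of_nonneg_right hF.le (norm_nonneg _)
end
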